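/- arXiv:2202.07312 — 3 statements merged into one kernel-verified Lean document; each statement's English description precedes it below -/
import Mathlib

section
/- The pair (F^c, F^o) satisfies the system of closed and open WDVV equations on M̃ if and only if at every point of M̃ the tensor c̃ is the structure-constant tensor of an associative multiplication, i.e., Σ_{μ=1}^{N+1} c̃^μ_{αβ} c̃^ν_{μγ} = Σ_{μ=1}^{N+1} c̃^μ_{γβ} c̃^ν_{μα} for all 1 ≤ α, β, γ, ν ≤ N+1. -/
/-- The partial derivative `∂f/∂t^i` of a function of `n` complex variables. -/
noncomputable def pd {n : ℕ} (i : Fin n) (f : (Fin n → ℂ) → ℂ) : (Fin n → ℂ) → ℂ :=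
  fun x => fderiv ℂ f x (Pi.single i 1)

/-- At a point of analyticity, partial derivatives commute. -/
theorem pd_comm_of_analyticAt {n : ℕ} {f : (Fin n → ℂ) → ℂ} {x : Fin n → ℂ}
    (hf : AnalyticAt ℂ f x) (i j : Fin n) : pd i (pd j f) x = pd j (pd i f) x := by
  have hd : DifferentiableAt ℂ (fderiv ℂ f) x := hf.fderiv.differentiableAt
  have key : ∀ k l : Fin n, pd k (pd l f) x =
      fderiv ℂ (fderiv ℂ f) x (Pi.single k 1) (Pi.single l 1) := by
    intro k l
    unfold pd
    rw [fderiv_clm_apply hd (differentiableAt_const _)]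
    simp
  have hsymm : IsSymmSndFDerivAt ℂ f x :=
    (hf.contDiffAt (n := 2)).isSymmSndFDerivAt (by simp)
  rw [key, key, hsymm.eq]

theorem analyticAt_pd {n : ℕ} {f : (Fin n → ℂ) → ℂ} {x : Fin n → ℂ}
    (hf : AnalyticAt ℂ f x) (i : Fin n) : AnalyticAt ℂ (pd i f) x :=
  ((ContinuousLinearMap.apply ℂ ℂ (Pi.single i 1 : Fin n → ℂ)).analyticAt
    (fderiv ℂ f x)).comp hf.fderiv

theorem pd_pd_pd_comm_right {n : ℕ} {f : (Fin n → ℂ) → ℂ} {x : Fin n → ℂ}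
    (hf : AnalyticAt ℂ f x) (i j k : Fin n) :
    pd i (pd j (pd k f)) x = pd i (pd k (pd j f)) x := by
  have h : pd j (pd k f) =ᶠ[nhds x] pd k (pd j f) :=
    hf.eventually_analyticAt.mono fun _ hy => pd_comm_of_analyticAt hy j k
  unfold pd at h ⊢
  rw [h.fderiv_eq]

theorem pd_zero {n : ℕ} (i : Fin n) : pd i (0 : (Fin n → ℂ) → ℂ) = 0 := by
  funext x
  simp [pd]

theorem pd_last_comp_castSucc {N : ℕ} (f : (Fin N → ℂ) → ℂ) :
    pd (Fin.last N) (fun t => f fun i : Fin N => t i.castSucc) = 0 := by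
  funext x
  by_cases hd : DifferentiableAt ℂ (fun t : Fin (N + 1) → ℂ => f fun i => t i.castSucc) x
  · rw [pd, ← hd.lineDeriv_eq_fderiv]
    simp [lineDeriv, Fin.castSucc_ne_last]
  · simp [pd, fderiv_zero_of_not_differentiableAt hd]

/-- Associativity of the structure constants built from a symmetric three-tensor `C` with no
component along the last direction, an invertible pairing with inverse `e`, and a symmetric
two-tensor `O`, is equivalent to the quadratic closed and open equations. -/
theorem closed_open_quadratic_iff_associative {N : ℕ} {η e : Matrix (Fin N) (Fin N) ℂ}
    (hηe : η * e = 1) (he : e.IsSymm)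
    {C : Fin (N + 1) → Fin (N + 1) → Fin (N + 1) → ℂ} {O : Fin (N + 1) → Fin (N + 1) → ℂ}
    (hC₁ : ∀ a b c, C a b c = C b a c) (hC₂ : ∀ a b c, C a b c = C a c b)
    (hC₀ : ∀ a b, C a b (Fin.last N) = 0)
    {ct : Fin (N + 1) → Fin (N + 1) → Fin (N + 1) → ℂ}
    (hct : ∀ (a : Fin N) b c, ct a.castSucc b c = ∑ μ, e a μ * C μ.castSucc b c)
    (hct_last : ∀ b c, ct (Fin.last N) b c = O b c) :
    ((∀ α β γ δ : Fin N,
        ∑ μ : Fin N, ∑ ν : Fin N, C α.castSucc β.castSucc μ.castSucc * e μ ν *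
            C ν.castSucc γ.castSucc δ.castSucc =
        ∑ μ : Fin N, ∑ ν : Fin N, C δ.castSucc β.castSucc μ.castSucc * e μ ν *
            C ν.castSucc γ.castSucc α.castSucc) ∧
     (∀ α β γ : Fin (N + 1),
        (∑ μ : Fin N, ∑ ν : Fin N, C α β μ.castSucc * e μ ν * O ν.castSucc γ)
          + O α β * O (Fin.last N) γ =
        (∑ μ : Fin N, ∑ ν : Fin N, C γ β μ.castSucc * e μ ν * O ν.castSucc α)
          + O γ β * O (Fin.last N) α)) ↔
    (∀ α β γ ν : Fin (N + 1),
        ∑ μ : Fin (N + 1), ct μ α β * ct ν μ γ = ∑ μ : Fin (N + 1), ct μ γ β * ct ν μ α) := by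
  have hrot : ∀ a b c, C a b c = C b c a := fun a b c => by rw [hC₁, hC₂]
  have hC₀' : ∀ a b, C (Fin.last N) a b = 0 := fun a b => by rw [hrot, hC₀]
  have hC₀'' : ∀ a b, C a (Fin.last N) b = 0 := fun a b => by rw [hC₂, hC₀]
  have contract : ∀ (a b : Fin (N + 1)) (X : Fin (N + 1) → ℂ),
      ∑ μ : Fin N, ct μ.castSucc a b * X μ.castSucc =
        ∑ μ : Fin N, ∑ ν : Fin N, C a b μ.castSucc * e μ ν * X ν.castSucc := by
    intro a b X
    rw [Finset.sum_comm]
    refine Finset.sum_congr rfl fun ν _ => ?_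
    rw [hct, Finset.sum_mul]
    refine Finset.sum_congr rfl fun μ _ => ?_
    rw [hrot μ.castSucc, ← he.apply ν μ]
    ring
  have hlast : ∀ α β γ, ∑ μ, ct μ α β * ct (Fin.last N) μ γ =
      (∑ μ : Fin N, ∑ ν : Fin N, C α β μ.castSucc * e μ ν * O ν.castSucc γ)
        + O α β * O (Fin.last N) γ := by
    intro α β γ
    simp only [Fin.sum_univ_castSucc, hct_last]
    rw [contract α β fun ν => O ν γ]
  have hinit : ∀ α β γ (ν : Fin N), ∑ μ, ct μ α β * ct ν.castSucc μ γ =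
      ∑ l, e ν l * ∑ μ : Fin N, ∑ κ : Fin N,
        C α β μ.castSucc * e μ κ * C κ.castSucc l.castSucc γ := by
    intro α β γ ν
    have hz : ct ν.castSucc (Fin.last N) γ = 0 := by simp [hct, hC₀'']
    rw [Fin.sum_univ_castSucc, hz, mul_zero, add_zero]
    simp only [fun l : Fin N => (contract α β fun κ => C κ l.castSucc γ).symm, hct ν,
      Finset.mul_sum]
    rw [Finset.sum_comm]
    refine Finset.sum_congr rfl fun l _ => Finset.sum_congr rfl fun μ _ => ?_
    rw [hC₁ l.castSucc]
    ring
  constructor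
  · rintro ⟨hclosed, hopen⟩ α β γ ν
    induction ν using Fin.lastCases with
    | last => rw [hlast, hlast, hopen]
    | cast ν =>
      rw [hinit, hinit]
      refine Finset.sum_congr rfl fun l _ => congrArg _ ?_
      induction α using Fin.lastCases with
      | last => simp [hC₀, hC₀']
      | cast α =>
        induction β using Fin.lastCases with
        | last => simp [hC₀'']
        | cast β =>
          induction γ using Fin.lastCases with
          | last => simp [hC₀, hC₀']
          | cast γ => exact hclosed α β l γ
  · intro h
    refine ⟨fun α β γ δ => ?_, fun α β γ => by rw [← hlast, ← hlast, h]⟩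
    have hmul : e.mulVec (fun l => ∑ μ : Fin N, ∑ κ : Fin N,
          C α.castSucc β.castSucc μ.castSucc * e μ κ * C κ.castSucc l.castSucc δ.castSucc) =
        e.mulVec (fun l => ∑ μ : Fin N, ∑ κ : Fin N,
          C δ.castSucc β.castSucc μ.castSucc * e μ κ * C κ.castSucc l.castSucc α.castSucc) := by
      funext ν
      simpa only [hinit, Matrix.mulVec, dotProduct] using h α.castSucc β.castSucc δ.castSucc ν.castSucc
    have hcancel := congrArg η.mulVec hmul
    simp only [Matrix.mulVec_mulVec, hηe, Matrix.one_mulVec] at hcancel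
    exact congrFun hcancel γ

/-- `(F^c, F^o)` satisfies the system of closed and open WDVV equations on `M̃`
iff at every point of `M̃` the tensor `c̃` is the structure-constant tensor of an associative
multiplication. -/
theorem closed_open_WDVV_iff_associativity (N : ℕ) (hN : 1 ≤ N)
    (η : Matrix (Fin N) (Fin N) ℂ) (hsym : η.IsSymm) (hinv : IsUnit η.det)
    (M : Set (Fin N → ℂ)) (hM : IsOpen M)
    (U : Set ℂ) (hU : IsOpen U)
    (Fc : (Fin N → ℂ) → ℂ) (Fo : (Fin (N + 1) → ℂ) → ℂ)
    (Mt : Set (Fin (N + 1) → ℂ))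
    (hMt : Mt = {t | (fun i : Fin N => t i.castSucc) ∈ M ∧ t (Fin.last N) ∈ U})
    (hFc : AnalyticOnNhd ℂ Fc M) (hFo : AnalyticOnNhd ℂ Fo Mt)
    -- `F^c` regarded as a function on `M̃ ⊆ ℂ^{N+1}`, independent of the last coordinate:
    (Fc' : (Fin (N + 1) → ℂ) → ℂ) (hFc' : Fc' = fun t => Fc fun i : Fin N => t i.castSucc)
    -- the tensor `c̃`:
    (ct : Fin (N + 1) → Fin (N + 1) → Fin (N + 1) → (Fin (N + 1) → ℂ) → ℂ)
    (hct : ∀ α β γ t, ct α β γ t =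
      if h : (α : ℕ) < N then
        ∑ μ : Fin N, η⁻¹ ⟨(α : ℕ), h⟩ μ * pd μ.castSucc (pd β (pd γ Fc')) t
      else pd β (pd γ Fo) t) :
    -- closed WDVV on M̃
    ((∀ t ∈ Mt, ∀ α β γ δ : Fin N,
        ∑ μ : Fin N, ∑ ν : Fin N,
          pd α.castSucc (pd β.castSucc (pd μ.castSucc Fc')) t * η⁻¹ μ ν *
            pd ν.castSucc (pd γ.castSucc (pd δ.castSucc Fc')) t =
        ∑ μ : Fin N, ∑ ν : Fin N,
          pd δ.castSucc (pd β.castSucc (pd μ.castSucc Fc')) t * η⁻¹ μ ν *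
            pd ν.castSucc (pd γ.castSucc (pd α.castSucc Fc')) t) ∧
    -- open WDVV on M̃
     (∀ t ∈ Mt, ∀ α β γ : Fin (N + 1),
        (∑ μ : Fin N, ∑ ν : Fin N,
          pd α (pd β (pd μ.castSucc Fc')) t * η⁻¹ μ ν * pd ν.castSucc (pd γ Fo) t)
          + pd α (pd β Fo) t * pd (Fin.last N) (pd γ Fo) t =
        (∑ μ : Fin N, ∑ ν : Fin N,
          pd γ (pd β (pd μ.castSucc Fc')) t * η⁻¹ μ ν * pd ν.castSucc (pd α Fo) t)
          + pd γ (pd β Fo) t * pd (Fin.last N) (pd α Fo) t)) ↔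
    -- associativity of `c̃` at every point of `M̃`
    (∀ t ∈ Mt, ∀ α β γ ν : Fin (N + 1),
        ∑ μ : Fin (N + 1), ct μ α β t * ct ν μ γ t =
        ∑ μ : Fin (N + 1), ct μ γ β t * ct ν μ α t) := by
  have hηe : η * η⁻¹ = 1 := Matrix.mul_nonsing_inv η hinv
  have he : (η⁻¹).IsSymm := by
    rw [Matrix.IsSymm, Matrix.transpose_nonsing_inv, hsym.eq]
  have hFc_an : ∀ t ∈ Mt, AnalyticAt ℂ Fc' t := by
    intro t ht
    rw [hMt] at ht
    rw [hFc']
    exact (hFc _ ht.1).comp_of_eq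
      (f := fun t : Fin (N + 1) → ℂ => fun i : Fin N => t i.castSucc)
      ((ContinuousLinearMap.pi fun i : Fin N =>
        ContinuousLinearMap.proj (R := ℂ) (φ := fun _ : Fin (N + 1) => ℂ)
          i.castSucc).analyticAt t) rfl
  rw [← forall₂_and]
  refine forall₂_congr fun t ht => ?_
  have hFt := hFc_an t ht
  refine closed_open_quadratic_iff_associative (C := fun a b c => pd a (pd b (pd c Fc')) t)
    (O := fun a b => pd a (pd b Fo) t) (ct := fun a b c => ct a b c t) hηe he
    (fun a b c => pd_comm_of_analyticAt (analyticAt_pd hFt c) a b)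
    (fun a b c => pd_pd_pd_comm_right hFt a b c) (fun a b => ?_)
    (fun a b c => by simp [hct]) (fun b c => by simp [hct])
  simp [hFc', pd_last_comp_castSucc, pd_zero]
end

section
/- For any r(z), r̃(z) ∈ g^o_{N+1,+}, as linear operators on V one has [r̂^o, \widehat{r̃}^o] = \widehat{[r(z),r̃(z)]}^o + Σ_{p≥3} G_p(r(z),r̃(z)) · ( ε ∂/∂q^{N+1}_p + (ε²/2) Σ_{i,j≥0, i+j=p−1} (−1)^{i+1} ∂²/∂q^{N+1}_i ∂q^{N+1}_j ), where on each polynomial only finitely many p contribute; moreover G_p(r(z),r̃(z)) = 0 whenever p is even. -/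
noncomputable section

/-- The polynomial algebra `V = ℂ[ε][q^α_a : 1 ≤ α ≤ N+1, a ≥ 0]`, with `ε` the polynomial
variable of the coefficient ring. -/
abbrev Vp (N : ℕ) := MvPolynomial (Fin (N + 1) × ℕ) (Polynomial ℂ)

/-- Membership in `g^o_{N+1,+}`: `r(z) = Σ_{i≥1} r_i z^i` (encoded by `i ↦ r_i`, with `r_0 = 0`),
`(r_i)^α_{N+1} = 0` for all `α`, and `η^{αμ}(r_i)^ν_μ η_{νβ} = (−1)^{i+1}(r_i)^α_β` for
`α, β ≤ N`. -/
def memGoPlus (N : ℕ) (η : Matrix (Fin N) (Fin N) ℂ)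
    (r : ℕ → Matrix (Fin (N + 1)) (Fin (N + 1)) ℂ) : Prop :=
  r 0 = 0 ∧
  (∀ (i : ℕ) (α : Fin (N + 1)), r i α (Fin.last N) = 0) ∧
  (∀ i : ℕ, 1 ≤ i → ∀ α β : Fin N,
    (∑ μ : Fin N, ∑ ν : Fin N, η⁻¹ α μ * r i ν.castSucc μ.castSucc * η ν β) =
      (-1 : ℂ) ^ (i + 1) * r i α.castSucc β.castSucc)

/-- `(r_i)^{N+1,α} := (r_i)^{N+1}_μ η^{μα}` for `α ≤ N`. -/
def rTop (N : ℕ) (η : Matrix (Fin N) (Fin N) ℂ)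
    (r : ℕ → Matrix (Fin (N + 1)) (Fin (N + 1)) ℂ) (i : ℕ) (α : Fin N) : ℂ :=
  ∑ μ : Fin N, r i (Fin.last N) μ.castSucc * η⁻¹ μ α

/-- The raised-index coefficients `(r_i)^{αβ}`. -/
def rUp (N : ℕ) (η : Matrix (Fin N) (Fin N) ℂ)
    (r : ℕ → Matrix (Fin (N + 1)) (Fin (N + 1)) ℂ) (i : ℕ) (α β : Fin (N + 1)) : ℂ :=
  if hβ : (β : ℕ) < N then ∑ μ : Fin N, r i α μ.castSucc * η⁻¹ μ ⟨(β : ℕ), hβ⟩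
  else if hα : (α : ℕ) < N then (-1 : ℂ) ^ (i + 1) * rTop N η r i ⟨(α : ℕ), hα⟩
  else 0

/-- The operator `r̂^o` on `V` (the sums over `i ≥ 1` are reindexed by `i+1`). -/
def hatRo (N : ℕ) (η : Matrix (Fin N) (Fin N) ℂ)
    (r : ℕ → Matrix (Fin (N + 1)) (Fin (N + 1)) ℂ) (P : Vp N) : Vp N :=
  -(∑ᶠ i : ℕ, ∑ᶠ j : ℕ, ∑ μ : Fin (N + 1), ∑ ν : Fin (N + 1),
      r (i + 1) μ ν • (MvPolynomial.X (ν, j) * MvPolynomial.pderiv (μ, i + 1 + j) P))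
  + MvPolynomial.C Polynomial.X *
      (∑ᶠ i : ℕ, ∑ ν : Fin N,
        ((-1 : ℂ) ^ (i + 1) * rTop N η r (i + 1) ν) • MvPolynomial.pderiv (ν.castSucc, i + 1) P)
  + (1 / 2 : ℂ) • (MvPolynomial.C (Polynomial.X ^ 2) *
      (∑ᶠ i : ℕ, ∑ᶠ j : ℕ, ∑ α : Fin (N + 1), ∑ β : Fin (N + 1),
        ((-1 : ℂ) ^ j * rUp N η r (i + j + 1) α β) •
          MvPolynomial.pderiv (α, i) (MvPolynomial.pderiv (β, j) P)))

/-- The commutator `[r(z), r̃(z)]` of matrix-valued series. -/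
def commSer {N : ℕ} (r r' : ℕ → Matrix (Fin (N + 1)) (Fin (N + 1)) ℂ) :
    ℕ → Matrix (Fin (N + 1)) (Fin (N + 1)) ℂ :=
  fun p => ∑ i ∈ Finset.range (p + 1), (r i * r' (p - i) - r' i * r (p - i))

/-- `G_p(r(z), r̃(z)) := Σ_{i,j≥1, i+j=p} ((−1)^{i+1} − (−1)^{j+1}) (r_i)^{N+1}_μ η^{μν} (r̃_j)^{N+1}_ν`. -/
def Gcoef (N : ℕ) (η : Matrix (Fin N) (Fin N) ℂ)
    (r r' : ℕ → Matrix (Fin (N + 1)) (Fin (N + 1)) ℂ) (p : ℕ) : ℂ :=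
  ∑ i ∈ Finset.Ico 1 p,
    ((-1 : ℂ) ^ (i + 1) - (-1 : ℂ) ^ (p - i + 1)) *
      ∑ μ : Fin N, ∑ ν : Fin N,
        r i (Fin.last N) μ.castSucc * η⁻¹ μ ν * r' (p - i) (Fin.last N) ν.castSucc

section ConstantCoefficientOperators

open MvPolynomial

variable {σ R : Type*} [CommRing R]

/-- The derivation of the polynomial algebra sending each variable to a constant. -/
def constDer (s : σ → R) : Derivation R (MvPolynomial σ R) (MvPolynomial σ R) :=
  mkDerivation R fun a => C (s a)

@[simp]
theorem constDer_X (s : σ → R) (a : σ) : constDer s (X a) = C (s a) :=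
  mkDerivation_X _ _ _

theorem constDer_add (s t : σ → R) : constDer (s + t) = constDer s + constDer t :=
  derivation_ext fun a => by simp

theorem constDer_sub (s t : σ → R) : constDer (s - t) = constDer s - constDer t :=
  derivation_ext fun a => by simp

theorem constDer_comm (s t : σ → R) (P : MvPolynomial σ R) :
    constDer s (constDer t P) = constDer t (constDer s P) := by
  have h : ⁅constDer s, constDer t⁆ = 0 :=
    derivation_ext fun a => by simp [Derivation.commutator_apply]
  simpa [Derivation.commutator_apply, sub_eq_zero] using DFunLike.congr_fun h P

theorem pderiv_eq_constDer [DecidableEq σ] (a : σ) :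
    (pderiv a : Derivation R (MvPolynomial σ R) _) = constDer (Pi.single a 1) :=
  derivation_ext fun b => by
    rw [pderiv_X, constDer_X]
    by_cases h : b = a
    · subst h; simp
    · simp [h]

theorem pderiv_constDer (a : σ) (s : σ → R) (P : MvPolynomial σ R) :
    pderiv a (constDer s P) = constDer s (pderiv a P) := by
  classical
  rw [pderiv_eq_constDer, constDer_comm]

theorem derivation_sum_apply {ι : Type*} (T : Finset ι)
    (D : ι → Derivation R (MvPolynomial σ R) (MvPolynomial σ R)) (P : MvPolynomial σ R) :
    (∑ i ∈ T, D i) P = ∑ i ∈ T, D i P := by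
  rw [← Derivation.coeFnAddMonoidHom_apply, map_sum, Finset.sum_apply]
  rfl

theorem derivation_eq_sum_pderiv (D : Derivation R (MvPolynomial σ R) (MvPolynomial σ R))
    {P : MvPolynomial σ R} {T : Finset σ} (hT : P.vars ⊆ T) :
    D P = ∑ a ∈ T, D (X a) * pderiv a P := by
  classical
  have h : D P = (∑ a ∈ T, D (X a) • pderiv a :
      Derivation R (MvPolynomial σ R) (MvPolynomial σ R)) P := by
    refine derivation_eq_of_forall_mem_vars fun i hi => ?_
    rw [derivation_sum_apply, Finset.sum_eq_single i]
    · simp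
    · intro b _ hb
      simp [pderiv_X_of_ne hb.symm]
    · intro h
      exact absurd (hT hi) h
  rw [h, derivation_sum_apply]
  simp

theorem constDer_eq_sum (s : σ → R) {P : MvPolynomial σ R} {T : Finset σ} (hT : P.vars ⊆ T) :
    constDer s P = ∑ a ∈ T, C (s a) * pderiv a P := by
  simpa using derivation_eq_sum_pderiv (constDer s) hT

/-- `L` is a homogeneous second order differential operator with constant coefficients, whose
commutators with the variables are the derivations `constDer (S a)`. -/
structure IsSecondOrder (L : MvPolynomial σ R →ₗ[R] MvPolynomial σ R) (S : σ → σ → R) : Prop where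
  map_one : L 1 = 0
  map_X_mul : ∀ a P, L (X a * P) = X a * L P + constDer (S a) P

namespace IsSecondOrder

variable {L L' : MvPolynomial σ R →ₗ[R] MvPolynomial σ R} {S S' : σ → σ → R}

theorem eq (h : IsSecondOrder L S) (h' : IsSecondOrder L' S) : L = L' := by
  refine LinearMap.ext fun P => ?_
  induction P using MvPolynomial.induction_on with
  | C a =>
    rw [← mul_one (C a), ← smul_eq_C_mul, map_smul, map_smul, h.map_one, h'.map_one]
  | add p q hp hq => rw [map_add, map_add, hp, hq]
  | mul_X p a hp => rw [mul_comm, h.map_X_mul, h'.map_X_mul, hp]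

theorem add (h : IsSecondOrder L S) (h' : IsSecondOrder L' S') :
    IsSecondOrder (L + L') (S + S') where
  map_one := by simp [h.map_one, h'.map_one]
  map_X_mul a P := by
    simp only [LinearMap.add_apply, h.map_X_mul, h'.map_X_mul, Pi.add_apply, constDer_add,
      Derivation.add_apply]
    ring

theorem sub (h : IsSecondOrder L S) (h' : IsSecondOrder L' S') :
    IsSecondOrder (L - L') (S - S') where
  map_one := by simp [h.map_one, h'.map_one]
  map_X_mul a P := by
    simp only [LinearMap.sub_apply, h.map_X_mul, h'.map_X_mul, Pi.sub_apply, constDer_sub,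
      Derivation.sub_apply]
    ring

theorem constDer_comm (h : IsSecondOrder L S) (s : σ → R) (P : MvPolynomial σ R) :
    L (constDer s P) = constDer s (L P) := by
  induction P using MvPolynomial.induction_on with
  | C a =>
    have : L (C a) = 0 := by rw [← mul_one (C a), ← smul_eq_C_mul, map_smul, h.map_one, smul_zero]
    simp [this]
  | add p q hp hq => simp only [map_add, hp, hq]
  | mul_X p a hp =>
    have hC : ∀ c q, L (C c * q) = C c * L q := fun c q => by
      rw [← smul_eq_C_mul, map_smul, smul_eq_C_mul]
    rw [mul_comm p, h.map_X_mul]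
    simp only [Derivation.leibniz, map_add, smul_eq_mul, constDer_X, h.map_X_mul, hp]
    rw [mul_comm p, hC, _root_.constDer_comm]
    ring

protected theorem comm (h : IsSecondOrder L S) (h' : IsSecondOrder L' S') (P : MvPolynomial σ R) :
    L (L' P) = L' (L P) := by
  induction P using MvPolynomial.induction_on with
  | C a =>
    have : L (C a) = 0 := by rw [← mul_one (C a), ← smul_eq_C_mul, map_smul, h.map_one, smul_zero]
    have h₂ : L' (C a) = 0 := by
      rw [← mul_one (C a), ← smul_eq_C_mul, map_smul, h'.map_one, smul_zero]
    simp [this, h₂]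
  | add p q hp hq => simp only [map_add, hp, hq]
  | mul_X p a hp =>
    rw [mul_comm p]
    simp only [h.map_X_mul, h'.map_X_mul, map_add, hp, h.constDer_comm, h'.constDer_comm]
    ring

/-- The commutator of an affine derivation with a second order operator. -/
theorem lie (h : IsSecondOrder L S) (D : Derivation R (MvPolynomial σ R) (MvPolynomial σ R))
    (T : σ → Finset σ) (d : σ → σ → R) (κ : σ → R)
    (hD : ∀ a, D (X a) = ∑ c ∈ T a, C (d a c) * X c + C (κ a)) :
    IsSecondOrder ((D : MvPolynomial σ R →ₗ[R] MvPolynomial σ R) ∘ₗ L - L ∘ₗ D)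
      (fun a b => -(∑ c ∈ T a, d a c * S c b) - ∑ c ∈ T b, d b c * S a c) where
  map_one := by simp [h.map_one]
  map_X_mul a P := by
    have hC : ∀ c q, L (C c * q) = C c * L q := fun c q => by
      rw [← smul_eq_C_mul, map_smul, smul_eq_C_mul]
    have hL : L (D (X a) * P) = D (X a) * L P + ∑ c ∈ T a, C (d a c) * constDer (S c) P := by
      rw [hD, add_mul, map_add, hC, Finset.sum_mul, map_sum, add_mul, Finset.sum_mul,
        add_right_comm, ← Finset.sum_add_distrib]
      congr 1
      refine Finset.sum_congr rfl fun c _ => ?_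
      rw [mul_assoc, hC, h.map_X_mul]
      ring
    have hlie : ⁅D, constDer (S a)⁆ = constDer fun b => -∑ c ∈ T b, d b c * S a c := by
      refine derivation_ext fun b => ?_
      simp [Derivation.commutator_apply, hD, map_sum, mul_comm]
    have hlie' : D (constDer (S a) P) - constDer (S a) (D P) =
        constDer (fun b => -∑ c ∈ T b, d b c * S a c) P := by
      rw [← Derivation.commutator_apply, hlie]
    have hsum : ∑ c ∈ T a, C (d a c) * constDer (S c) P =
        constDer (fun b => ∑ c ∈ T a, d a c * S c b) P := by
      have : (∑ c ∈ T a, C (d a c) • constDer (S c) :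
          Derivation R (MvPolynomial σ R) (MvPolynomial σ R)) =
          constDer (fun b => ∑ c ∈ T a, d a c * S c b) :=
        derivation_ext fun b => by
          rw [derivation_sum_apply, constDer_X, map_sum]
          refine Finset.sum_congr rfl fun c _ => ?_
          rw [Derivation.smul_apply, constDer_X, smul_eq_mul, map_mul]
      rw [← this, derivation_sum_apply]
      simp
    have hsplit : constDer (fun b => -(∑ c ∈ T a, d a c * S c b) - ∑ c ∈ T b, d b c * S a c) =
        constDer (fun b => -∑ c ∈ T b, d b c * S a c) -
          constDer (fun b => ∑ c ∈ T a, d a c * S c b) := by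
      rw [← constDer_sub]
      congr 1
      funext b
      simp only [Pi.sub_apply]
      ring
    simp only [LinearMap.sub_apply, LinearMap.comp_apply, Derivation.coeFn_coe, h.map_X_mul,
      Derivation.leibniz, map_add, smul_eq_mul, hsplit, Derivation.sub_apply, ← hlie', ← hsum]
    rw [mul_comm P, hL]
    ring

end IsSecondOrder

theorem sum_pderiv_constDer_eq (w : σ → σ → R) {P : MvPolynomial σ R} {T : Finset σ}
    (hT : P.vars ⊆ T) :
    ∑ a ∈ P.vars, pderiv a (constDer (w a) P) = ∑ a ∈ T, pderiv a (constDer (w a) P) := by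
  refine Finset.sum_subset hT fun a _ ha => ?_
  rw [pderiv_constDer, pderiv_eq_zero_of_notMem_vars ha, map_zero]

/-- The operator `∑ w_{ab} ∂_a ∂_b`. -/
def secondOrder (w : σ → σ → R) : MvPolynomial σ R →ₗ[R] MvPolynomial σ R where
  toFun P := ∑ a ∈ P.vars, pderiv a (constDer (w a) P)
  map_add' P Q := by
    classical
    rw [sum_pderiv_constDer_eq w (vars_add_subset P Q),
      sum_pderiv_constDer_eq w (P := P) (T := P.vars ∪ Q.vars) Finset.subset_union_left,
      sum_pderiv_constDer_eq w (P := Q) (T := P.vars ∪ Q.vars) Finset.subset_union_right,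
      ← Finset.sum_add_distrib]
    simp
  map_smul' c P := by
    have h : (c • P).vars ⊆ P.vars := by
      classical
      rw [smul_eq_C_mul]
      refine (vars_mul _ _).trans ?_
      simp
    rw [sum_pderiv_constDer_eq w h, Finset.smul_sum]
    simp

theorem secondOrder_apply (w : σ → σ → R) {P : MvPolynomial σ R} {T : Finset σ}
    (hT : P.vars ⊆ T) :
    secondOrder w P = ∑ a ∈ T, pderiv a (constDer (w a) P) :=
  sum_pderiv_constDer_eq w hT

theorem secondOrder_eq_sum (w : σ → σ → R) {P : MvPolynomial σ R} {T : Finset σ}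
    (hT : P.vars ⊆ T) :
    secondOrder w P = ∑ a ∈ T, ∑ b ∈ T, C (w a b) * pderiv a (pderiv b P) := by
  rw [secondOrder_apply w hT]
  refine Finset.sum_congr rfl fun a _ => ?_
  rw [constDer_eq_sum _ hT, map_sum]
  exact Finset.sum_congr rfl fun b _ => pderiv_C_mul

theorem isSecondOrder_secondOrder [Nontrivial R] (w : σ → σ → R) :
    IsSecondOrder (secondOrder w) (fun a b => w a b + w b a) where
  map_one := by
    rw [secondOrder_apply w (T := ∅) (by simp), Finset.sum_empty]
  map_X_mul c P := by
    classical
    set T := insert c P.vars with hTdef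
    have hP : P.vars ⊆ T := Finset.subset_insert _ _
    have hXP : (X c * P).vars ⊆ T := by
      refine (vars_mul _ _).trans (Finset.union_subset ?_ hP)
      simp [hTdef]
    have hc : c ∈ T := Finset.mem_insert_self _ _
    have h₁ : ∀ a, pderiv a (constDer (w a) (X c * P)) =
        X c * pderiv a (constDer (w a) P) + (if a = c then constDer (w a) P else 0)
          + C (w a c) * pderiv a P := fun a => by
      simp only [Derivation.leibniz, smul_eq_mul, map_add, constDer_X, pderiv_C, mul_zero]
      by_cases h : a = c
      · subst h; simp
      · simp [pderiv_X_of_ne (Ne.symm h), h]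
    have h₂ : constDer (fun b => w c b + w b c) P =
        constDer (w c) P + constDer (fun b => w b c) P :=
      DFunLike.congr_fun (constDer_add (w c) (fun b => w b c)) P
    rw [secondOrder_apply w hXP, secondOrder_apply w hP, h₂,
      constDer_eq_sum (fun b => w b c) hP]
    simp only [h₁, Finset.sum_add_distrib, Finset.sum_ite_eq', hc, if_true, Finset.mul_sum]
    ring

end ConstantCoefficientOperators

section IndexRaising

variable {N : ℕ} {η : Matrix (Fin N) (Fin N) ℂ}
  {r r' : ℕ → Matrix (Fin (N + 1)) (Fin (N + 1)) ℂ}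

theorem neg_one_pow_eq_of_even_add {m n : ℕ} (h : Even (m + n)) : (-1 : ℂ) ^ m = (-1) ^ n := by
  rw [Nat.even_add] at h
  rcases Nat.even_or_odd m with hm | hm
  · rw [hm.neg_one_pow, (h.1 hm).neg_one_pow]
  · have hn : Odd n := by
      rw [← Nat.not_even_iff_odd] at hm ⊢
      exact fun hn => hm (h.2 hn)
    rw [hm.neg_one_pow, hn.neg_one_pow]

theorem memGoPlus.apply_last (hr : memGoPlus N η r) (i : ℕ) (α : Fin (N + 1)) :
    r i α (Fin.last N) = 0 :=
  hr.2.1 i α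

theorem inv_apply_comm (hsym : η.IsSymm) (μ ν : Fin N) : η⁻¹ μ ν = η⁻¹ ν μ := by
  have h : (η⁻¹).IsSymm := by
    rw [Matrix.IsSymm, Matrix.transpose_nonsing_inv, hsym]
  exact h.apply ν μ

/-- The matrix `A` with its lower index raised by `η⁻¹`. -/
def raiseIdx (η : Matrix (Fin N) (Fin N) ℂ) (A : Matrix (Fin (N + 1)) (Fin (N + 1)) ℂ)
    (α : Fin (N + 1)) (β : Fin N) : ℂ :=
  ∑ μ : Fin N, A α μ.castSucc * η⁻¹ μ β

theorem raiseIdx_sub (A B : Matrix (Fin (N + 1)) (Fin (N + 1)) ℂ) (α : Fin (N + 1)) (β : Fin N) :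
    raiseIdx η (A - B) α β = raiseIdx η A α β - raiseIdx η B α β := by
  simp [raiseIdx, sub_mul, Finset.sum_sub_distrib]

theorem raiseIdx_sum {ι : Type*} (s : Finset ι) (A : ι → Matrix (Fin (N + 1)) (Fin (N + 1)) ℂ)
    (α : Fin (N + 1)) (β : Fin N) :
    raiseIdx η (∑ i ∈ s, A i) α β = ∑ i ∈ s, raiseIdx η (A i) α β := by
  simp only [raiseIdx, Matrix.sum_apply, Finset.sum_mul]
  exact Finset.sum_comm

@[simp]
theorem rUp_castSucc (i : ℕ) (α : Fin (N + 1)) (β : Fin N) :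
    rUp N η r i α β.castSucc = raiseIdx η (r i) α β := by
  simp [rUp, raiseIdx]

theorem rTop_eq_raiseIdx (i : ℕ) (α : Fin N) :
    rTop N η r i α = raiseIdx η (r i) (Fin.last N) α :=
  rfl

@[simp]
theorem rUp_castSucc_last (i : ℕ) (α : Fin N) :
    rUp N η r i α.castSucc (Fin.last N) = (-1) ^ (i + 1) * raiseIdx η (r i) (Fin.last N) α := by
  simp [rUp, rTop_eq_raiseIdx]

@[simp]
theorem rUp_last_last (i : ℕ) : rUp N η r i (Fin.last N) (Fin.last N) = 0 := by
  simp [rUp]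

theorem raiseIdx_comm (hsym : η.IsSymm) (hinv : IsUnit η.det) (hr : memGoPlus N η r) (i : ℕ)
    (α β : Fin N) :
    raiseIdx η (r i) β.castSucc α = (-1) ^ (i + 1) * raiseIdx η (r i) α.castSucc β := by
  rcases Nat.eq_zero_or_pos i with rfl | hi
  · simp [raiseIdx, hr.1]
  set M : Matrix (Fin N) (Fin N) ℂ := (r i).submatrix Fin.castSucc Fin.castSucc with hM
  have h₁ : η⁻¹ * M.transpose * η = ((-1 : ℂ) ^ (i + 1)) • M := by
    ext a b
    rw [Matrix.smul_apply, smul_eq_mul, hM, Matrix.submatrix_apply, ← hr.2.2 i hi a b]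
    simp only [Matrix.mul_apply, Matrix.transpose_apply, Matrix.submatrix_apply, Finset.sum_mul]
    exact Finset.sum_comm
  have h₂ : η⁻¹ * M.transpose = ((-1 : ℂ) ^ (i + 1)) • (M * η⁻¹) := by
    rw [← Matrix.smul_mul, ← h₁, Matrix.mul_nonsing_inv_cancel_right _ _ hinv]
  have h₃ := congrFun (congrFun h₂ α) β
  simp only [Matrix.smul_apply, Matrix.mul_apply, smul_eq_mul, Matrix.transpose_apply, hM,
    Matrix.submatrix_apply] at h₃
  rw [raiseIdx, raiseIdx, ← h₃]
  exact Finset.sum_congr rfl fun μ _ => by rw [mul_comm, inv_apply_comm hsym]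

theorem neg_one_pow_mul_self (n : ℕ) (x : ℂ) : (-1) ^ n * ((-1) ^ n * x) = x := by
  rw [← mul_assoc, ← pow_add, (Even.add_self n).neg_one_pow, one_mul]

theorem rUp_comm (hsym : η.IsSymm) (hinv : IsUnit η.det) (hr : memGoPlus N η r) (i : ℕ)
    (α β : Fin (N + 1)) :
    rUp N η r i β α = (-1) ^ (i + 1) * rUp N η r i α β := by
  induction α using Fin.lastCases with
  | last =>
    induction β using Fin.lastCases with
    | last => simp
    | cast β => simp
  | cast α =>
    induction β using Fin.lastCases with
    | last => simp [neg_one_pow_mul_self]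
    | cast β => simpa using raiseIdx_comm hsym hinv hr i α β

theorem sum_mul_rUp_castSucc (A : Matrix (Fin (N + 1)) (Fin (N + 1)) ℂ) (m : ℕ)
    (α : Fin (N + 1)) (β : Fin N) :
    ∑ γ, A α γ * rUp N η r m γ β.castSucc = raiseIdx η (A * r m) α β := by
  simp only [rUp_castSucc, raiseIdx, Matrix.mul_apply, Finset.sum_mul, Finset.mul_sum, mul_assoc]
  exact Finset.sum_comm

theorem sum_rUp_mul_castSucc (hsym : η.IsSymm) (hinv : IsUnit η.det) (hr : memGoPlus N η r)
    (hr' : memGoPlus N η r') (k m : ℕ) (α : Fin (N + 1)) (β : Fin N) :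
    ∑ γ, rUp N η r' m α γ * r k β.castSucc γ =
      (-1) ^ (k + 1) * raiseIdx η (r' m * r k) α β := by
  have h : ∀ μ : Fin N, ∑ γ : Fin N, η⁻¹ μ γ * r k β.castSucc γ.castSucc =
      (-1) ^ (k + 1) * rUp N η r k μ.castSucc β.castSucc := fun μ => by
    rw [rUp_castSucc, ← raiseIdx_comm hsym hinv hr, raiseIdx]
    exact Finset.sum_congr rfl fun γ _ => by rw [mul_comm, inv_apply_comm hsym]
  rw [← sum_mul_rUp_castSucc, Fin.sum_univ_castSucc, Fin.sum_univ_castSucc, hr.apply_last,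
    hr'.apply_last, mul_zero, zero_mul, add_zero, add_zero, Finset.mul_sum]
  simp only [rUp_castSucc _ α, raiseIdx, Finset.sum_mul, mul_assoc]
  rw [Finset.sum_comm]
  simp only [← Finset.mul_sum, h]
  rw [Finset.mul_sum]
  exact Finset.sum_congr rfl fun μ _ => by ring

/-- The pairing by `η⁻¹` of the last rows of `r_k` and `r'_m`. -/
def lastPair (η : Matrix (Fin N) (Fin N) ℂ) (r r' : ℕ → Matrix (Fin (N + 1)) (Fin (N + 1)) ℂ)
    (k m : ℕ) : ℂ :=
  ∑ μ : Fin N, ∑ ν : Fin N,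
    r k (Fin.last N) μ.castSucc * η⁻¹ μ ν * r' m (Fin.last N) ν.castSucc

theorem lastPair_comm (hsym : η.IsSymm) (k m : ℕ) : lastPair η r' r m k = lastPair η r r' k m := by
  rw [lastPair, Finset.sum_comm, lastPair]
  refine Finset.sum_congr rfl fun μ _ => Finset.sum_congr rfl fun ν _ => ?_
  rw [inv_apply_comm hsym]
  ring

theorem sum_rUp_mul_last (hsym : η.IsSymm) (hr : memGoPlus N η r) (k m : ℕ) :
    ∑ γ, rUp N η r' m (Fin.last N) γ * r k (Fin.last N) γ = lastPair η r r' k m := by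
  rw [← lastPair_comm hsym, lastPair, Fin.sum_univ_castSucc, hr.apply_last, mul_zero, add_zero,
    Finset.sum_comm]
  simp only [rUp_castSucc, raiseIdx, Finset.sum_mul]

theorem sum_mul_rUp_last (hsym : η.IsSymm) (hr : memGoPlus N η r) (k m : ℕ) :
    ∑ γ, r k (Fin.last N) γ * rUp N η r' m γ (Fin.last N) =
      (-1) ^ (m + 1) * lastPair η r r' k m := by
  rw [← sum_rUp_mul_last hsym hr, Fin.sum_univ_castSucc, Fin.sum_univ_castSucc, hr.apply_last,
    mul_zero, zero_mul, add_zero, add_zero, Finset.mul_sum]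
  refine Finset.sum_congr rfl fun γ _ => ?_
  rw [rUp_castSucc_last, rUp_castSucc]
  ring

/-- The coefficient of `z ^ p` in the product of two matrix-valued series. -/
def convSer (r r' : ℕ → Matrix (Fin (N + 1)) (Fin (N + 1)) ℂ) (p : ℕ) :
    Matrix (Fin (N + 1)) (Fin (N + 1)) ℂ :=
  ∑ i ∈ Finset.range (p + 1), r i * r' (p - i)

theorem sum_range_succ_flip {M : Type*} [AddCommMonoid M] (f : ℕ → ℕ → M) (p : ℕ) :
    ∑ i ∈ Finset.range (p + 1), f (p - i) i = ∑ i ∈ Finset.range (p + 1), f i (p - i) := by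
  rw [← Finset.sum_range_reflect]
  refine Finset.sum_congr rfl fun i hi => ?_
  have := Finset.mem_range.1 hi
  rw [show p - (p + 1 - 1 - i) = i by omega, show p + 1 - 1 - i = p - i by omega]

theorem convSer_flip (p : ℕ) :
    ∑ i ∈ Finset.range (p + 1), r (p - i) * r' i = convSer r r' p :=
  sum_range_succ_flip (fun a b => r a * r' b) p

theorem commSer_eq (p : ℕ) : commSer r r' p = convSer r r' p - convSer r' r p := by
  simp [commSer, convSer, Finset.sum_sub_distrib]

theorem commSer_zero (h : r 0 = 0) : commSer r r' 0 = 0 := by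
  simp [commSer, h]

theorem Gcoef_eq_sum_range (hr : memGoPlus N η r) (hr' : memGoPlus N η r') (p : ℕ) :
    Gcoef N η r r' p = ∑ i ∈ Finset.range (p + 1),
      ((-1 : ℂ) ^ (i + 1) - (-1) ^ (p - i + 1)) * lastPair η r r' i (p - i) := by
  refine Finset.sum_subset (fun i hi => ?_) fun i hi hi' => ?_
  · simp only [Finset.mem_Ico, Finset.mem_range] at hi ⊢
    omega
  · have h : i = 0 ∨ p - i = 0 := by
      simp only [Finset.mem_Ico, Finset.mem_range] at hi hi'
      omega
    rcases h with h | h <;> simp [h, hr.1, hr'.1]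

theorem Gcoef_eq_zero_of_even {p : ℕ} (hp : Even p) : Gcoef N η r r' p = 0 := by
  refine Finset.sum_eq_zero fun i hi => ?_
  have h : (-1 : ℂ) ^ (i + 1) = (-1) ^ (p - i + 1) := by
    refine neg_one_pow_eq_of_even_add ?_
    have := Finset.mem_Ico.1 hi
    rw [show i + 1 + (p - i + 1) = p + 2 by omega]
    exact hp.add even_two
  rw [h, sub_self, zero_mul]

theorem Gcoef_eq_zero_of_lt_three {p : ℕ} (hp : p < 3) : Gcoef N η r r' p = 0 := by
  interval_cases p
  · exact Gcoef_eq_zero_of_even (by decide)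
  · simp [Gcoef]
  · exact Gcoef_eq_zero_of_even (by decide)

theorem shift_commutator (hsym : η.IsSymm) (hinv : IsUnit η.det) (hr : memGoPlus N η r)
    (hr' : memGoPlus N η r') (α : Fin (N + 1)) (k : ℕ) :
    ∑ l ∈ Finset.range (k + 1), ∑ γ, r (k - l) α γ * ((-1) ^ l * rUp N η r' l (Fin.last N) γ) -
      ∑ l ∈ Finset.range (k + 1), ∑ γ, r' (k - l) α γ * ((-1) ^ l * rUp N η r l (Fin.last N) γ) =
    (-1) ^ k * rUp N η (commSer r r') k (Fin.last N) α +
      if α = Fin.last N then Gcoef N η r r' k else 0 := by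
  have pull : ∀ (s t : ℕ → Matrix (Fin (N + 1)) (Fin (N + 1)) ℂ) (l : ℕ),
      ∑ γ, s (k - l) α γ * ((-1) ^ l * rUp N η t l (Fin.last N) γ) =
        (-1) ^ l * ∑ γ, rUp N η t l (Fin.last N) γ * s (k - l) α γ := fun s t l => by
    rw [Finset.mul_sum]
    exact Finset.sum_congr rfl fun γ _ => by ring
  simp only [pull]
  induction α using Fin.lastCases with
  | last =>
    simp only [sum_rUp_mul_last hsym hr, sum_rUp_mul_last hsym hr', rUp_last_last, if_true,
      mul_zero, zero_add, Gcoef_eq_sum_range hr hr']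
    rw [sum_range_succ_flip (fun a b => (-1 : ℂ) ^ b * lastPair η r r' a b) k,
      ← Finset.sum_sub_distrib]
    refine Finset.sum_congr rfl fun i _ => ?_
    rw [lastPair_comm hsym]
    ring
  | cast α =>
    have key : ∀ (s t : ℕ → Matrix (Fin (N + 1)) (Fin (N + 1)) ℂ), memGoPlus N η s →
        memGoPlus N η t → ∑ l ∈ Finset.range (k + 1),
          (-1) ^ l * ∑ γ, rUp N η t l (Fin.last N) γ * s (k - l) α.castSucc γ =
        -((-1) ^ k * raiseIdx η (convSer t s k) (Fin.last N) α) := fun s t hs ht => by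
      rw [convSer, raiseIdx_sum, Finset.mul_sum, ← Finset.sum_neg_distrib]
      refine Finset.sum_congr rfl fun l hl => ?_
      have := Finset.mem_range.1 hl
      rw [sum_rUp_mul_castSucc hsym hinv hs ht, ← mul_assoc, ← pow_add,
        show l + (k - l + 1) = k + 1 by omega]
      ring
    rw [key r r' hr hr', key r' r hr' hr, rUp_castSucc, commSer_eq, raiseIdx_sub,
      if_neg (Fin.castSucc_lt_last α).ne]
    ring

/-- The matrix of the second order part of `hatRo`. -/
def quadMat (η : Matrix (Fin N) (Fin N) ℂ) (r : ℕ → Matrix (Fin (N + 1)) (Fin (N + 1)) ℂ)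
    (a b : Fin (N + 1) × ℕ) : ℂ :=
  (-1) ^ b.2 * rUp N η r (a.2 + b.2 + 1) a.1 b.1

theorem quadMat_comm (hsym : η.IsSymm) (hinv : IsUnit η.det) (hr : memGoPlus N η r)
    (a b : Fin (N + 1) × ℕ) : quadMat η r b a = quadMat η r a b := by
  rw [quadMat, quadMat, add_comm b.2 a.2, rUp_comm hsym hinv hr _ a.1 b.1, ← mul_assoc, ← pow_add]
  congr 1
  exact neg_one_pow_eq_of_even_add ⟨a.2 + b.2 + 1, by ring⟩

/-- The action of `r` on the quadratic form `quadMat η r'`. -/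
def quadAct (η : Matrix (Fin N) (Fin N) ℂ) (r r' : ℕ → Matrix (Fin (N + 1)) (Fin (N + 1)) ℂ)
    (a b : Fin (N + 1) × ℕ) : ℂ :=
  ∑ l ∈ Finset.range (a.2 + 1), ∑ γ, r (a.2 - l) a.1 γ * quadMat η r' (γ, l) b +
    ∑ l ∈ Finset.range (b.2 + 1), ∑ γ, r (b.2 - l) b.1 γ * quadMat η r' a (γ, l)

theorem quadAct_comm (hsym : η.IsSymm) (hinv : IsUnit η.det) (hr' : memGoPlus N η r')
    (a b : Fin (N + 1) × ℕ) : quadAct η r r' b a = quadAct η r r' a b := by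
  simp only [quadAct, quadMat_comm hsym hinv hr' b, quadMat_comm hsym hinv hr' _ a]
  exact add_comm _ _

theorem quadAct_castSucc (hsym : η.IsSymm) (hinv : IsUnit η.det) (hr : memGoPlus N η r)
    (hr' : memGoPlus N η r') (α : Fin (N + 1)) (β : Fin N) (i j : ℕ) :
    quadAct η r r' (α, i) (β.castSucc, j) = (-1) ^ j *
      (∑ k ∈ Finset.range (i + 1), raiseIdx η (r k * r' (i + j + 1 - k)) α β -
        ∑ l ∈ Finset.range (j + 1), raiseIdx η (r' (i + 1 + l) * r (j - l)) α β) := by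
  rw [mul_sub, sub_eq_add_neg, quadAct]
  congr 1
  · rw [Finset.mul_sum]
    refine Eq.trans ?_ (Eq.trans (sum_range_succ_flip
      (fun a b => (-1 : ℂ) ^ j * raiseIdx η (r a * r' (b + j + 1)) α β) i) ?_)
    · refine Finset.sum_congr rfl fun l _ => ?_
      rw [← sum_mul_rUp_castSucc, Finset.mul_sum]
      refine Finset.sum_congr rfl fun γ _ => ?_
      simp only [quadMat]
      ring
    · refine Finset.sum_congr rfl fun k hk => ?_
      have := Finset.mem_range.1 hk
      rw [show i - k + j + 1 = i + j + 1 - k by omega]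
  · rw [Finset.mul_sum, ← Finset.sum_neg_distrib]
    refine Finset.sum_congr rfl fun l hl => ?_
    have := Finset.mem_range.1 hl
    have h := sum_rUp_mul_castSucc hsym hinv hr hr' (j - l) (i + 1 + l) α β
    have hs : (-1 : ℂ) ^ l * (-1) ^ (j - l + 1) = -(-1) ^ j := by
      rw [← pow_add, show l + (j - l + 1) = j + 1 by omega]
      ring
    rw [← neg_mul, ← hs, mul_assoc, ← h, Finset.mul_sum]
    refine Finset.sum_congr rfl fun γ _ => ?_
    simp only [quadMat, show i + l + 1 = i + 1 + l by omega]
    ring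

theorem quadAct_last (hsym : η.IsSymm) (hr : memGoPlus N η r) (i j : ℕ) :
    quadAct η r r' (Fin.last N, i) (Fin.last N, j) =
      ∑ k ∈ Finset.range (i + 1), (-1) ^ (i + k) * lastPair η r r' k (i + j + 1 - k) +
        ∑ l ∈ Finset.range (j + 1), (-1) ^ l * lastPair η r r' (j - l) (i + 1 + l) := by
  rw [quadAct]
  congr 1
  · refine Eq.trans ?_ (Eq.trans (sum_range_succ_flip
      (fun a b => (-1 : ℂ) ^ b * lastPair η r r' a (b + j + 1)) i) ?_)
    · refine Finset.sum_congr rfl fun l _ => ?_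
      have hs : (-1 : ℂ) ^ l = (-1) ^ j * (-1) ^ (l + j + 1 + 1) := by
        rw [← pow_add]
        exact neg_one_pow_eq_of_even_add ⟨l + j + 1, by ring⟩
      rw [hs, mul_assoc, ← sum_mul_rUp_last hsym hr, Finset.mul_sum]
      refine Finset.sum_congr rfl fun γ _ => ?_
      simp only [quadMat]
      ring
    · refine Finset.sum_congr rfl fun k hk => ?_
      have := Finset.mem_range.1 hk
      rw [show i - k + j + 1 = i + j + 1 - k by omega]
      congr 1
      exact neg_one_pow_eq_of_even_add ⟨i, by omega⟩
  · refine Finset.sum_congr rfl fun l _ => ?_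
    rw [← sum_rUp_mul_last hsym hr, Finset.mul_sum]
    refine Finset.sum_congr rfl fun γ _ => ?_
    simp only [quadMat, show i + l + 1 = i + 1 + l by omega]
    ring

theorem quadAct_sub_castSucc (hsym : η.IsSymm) (hinv : IsUnit η.det) (hr : memGoPlus N η r)
    (hr' : memGoPlus N η r') (α : Fin (N + 1)) (β : Fin N) (i j : ℕ) :
    quadAct η r r' (α, i) (β.castSucc, j) - quadAct η r' r (α, i) (β.castSucc, j) =
      quadMat η (commSer r r') (α, i) (β.castSucc, j) := by
  have key : ∀ s t : ℕ → Matrix (Fin (N + 1)) (Fin (N + 1)) ℂ,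
      raiseIdx η (convSer s t (i + j + 1)) α β =
        ∑ k ∈ Finset.range (i + 1), raiseIdx η (s k * t (i + j + 1 - k)) α β +
          ∑ l ∈ Finset.range (j + 1), raiseIdx η (s (i + 1 + l) * t (j - l)) α β := fun s t => by
    rw [convSer, raiseIdx_sum, show i + j + 1 + 1 = i + 1 + (j + 1) by ring, Finset.sum_range_add]
    congr 1
    refine Finset.sum_congr rfl fun l _ => ?_
    rw [show i + j + 1 - (i + 1 + l) = j - l by omega]
  rw [quadAct_castSucc hsym hinv hr hr', quadAct_castSucc hsym hinv hr' hr, quadMat]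
  simp only [rUp_castSucc, commSer_eq, raiseIdx_sub, key]
  ring

theorem quadAct_sub_last (hsym : η.IsSymm) (hr : memGoPlus N η r)
    (hr' : memGoPlus N η r') (i j : ℕ) :
    quadAct η r r' (Fin.last N, i) (Fin.last N, j) -
        quadAct η r' r (Fin.last N, i) (Fin.last N, j) =
      1 / 2 * Gcoef N η r r' (i + j + 1) * ((-1) ^ (i + 1) + (-1) ^ (j + 1)) := by
  have key : ∀ s t : ℕ → Matrix (Fin (N + 1)) (Fin (N + 1)) ℂ,
      ∑ k ∈ Finset.range (i + j + 1 + 1), (-1) ^ (i + k) * lastPair η s t k (i + j + 1 - k) =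
        ∑ k ∈ Finset.range (i + 1), (-1) ^ (i + k) * lastPair η s t k (i + j + 1 - k) -
          ∑ l ∈ Finset.range (j + 1), (-1) ^ l * lastPair η t s (j - l) (i + 1 + l) :=
        fun s t => by
    rw [show i + j + 1 + 1 = i + 1 + (j + 1) by ring, Finset.sum_range_add, sub_eq_add_neg,
      ← Finset.sum_neg_distrib]
    congr 1
    refine Finset.sum_congr rfl fun l _ => ?_
    have hs : (-1 : ℂ) ^ (i + (i + 1 + l)) = -(-1) ^ l := by
      rw [show i + (i + 1 + l) = 2 * i + 1 + l by ring, pow_add, pow_add, pow_mul]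
      simp
    rw [show i + j + 1 - (i + 1 + l) = j - l by omega, lastPair_comm hsym, hs, neg_mul]
  have total : quadAct η r r' (Fin.last N, i) (Fin.last N, j) -
        quadAct η r' r (Fin.last N, i) (Fin.last N, j) =
      ∑ k ∈ Finset.range (i + j + 1 + 1), (-1) ^ (i + k) * lastPair η r r' k (i + j + 1 - k) -
      ∑ k ∈ Finset.range (i + j + 1 + 1), (-1) ^ (i + k) * lastPair η r' r k (i + j + 1 - k) := by
    rw [quadAct_last hsym hr, quadAct_last hsym hr', key, key]
    ring
  rw [total, Gcoef_eq_sum_range hr hr', ← sum_range_succ_flip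
    (fun a b => (-1 : ℂ) ^ (i + a) * lastPair η r' r a b), ← Finset.sum_sub_distrib,
    Finset.mul_sum, Finset.sum_mul]
  refine Finset.sum_congr rfl fun k hk => ?_
  have := Finset.mem_range.1 hk
  have h₁ : (-1 : ℂ) ^ (i + (i + j + 1 - k)) = -((-1) ^ j * (-1) ^ k) := by
    rw [neg_one_pow_eq_of_even_add (n := j + k + 1) ⟨i + j + 1, by omega⟩]
    ring
  have h₂ : (-1 : ℂ) ^ (i + j + 1 - k + 1) = (-1) ^ i * (-1) ^ j * (-1) ^ k := by
    rw [← pow_add, ← pow_add]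
    exact neg_one_pow_eq_of_even_add ⟨i + j + 1, by omega⟩
  have hi : ((-1 : ℂ) ^ i) ^ 2 = 1 := by rw [← pow_mul, mul_comm, pow_mul]; simp
  have hj : ((-1 : ℂ) ^ j) ^ 2 = 1 := by rw [← pow_mul, mul_comm, pow_mul]; simp
  rw [lastPair_comm (r := r) (r' := r') hsym, h₁, h₂, pow_add, pow_succ _ k,
    pow_succ _ i, pow_succ _ j]
  linear_combination (-(1 / 2 : ℂ) * (-1) ^ k * (-1) ^ j * lastPair η r r' k (i + j + 1 - k)) * hi +
    (-(1 / 2 : ℂ) * (-1) ^ k * (-1) ^ i * lastPair η r r' k (i + j + 1 - k)) * hj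

theorem quadAct_sub (hsym : η.IsSymm) (hinv : IsUnit η.det) (hr : memGoPlus N η r)
    (hr' : memGoPlus N η r') (a b : Fin (N + 1) × ℕ) :
    quadAct η r r' a b - quadAct η r' r a b =
      1 / 2 * (quadMat η (commSer r r') a b + quadMat η (commSer r r') b a) +
        if a.1 = Fin.last N ∧ b.1 = Fin.last N then
          1 / 2 * Gcoef N η r r' (a.2 + b.2 + 1) * ((-1) ^ (a.2 + 1) + (-1) ^ (b.2 + 1))
        else 0 := by
  obtain ⟨α, i⟩ := a
  obtain ⟨β, j⟩ := b
  have hlast : ∀ (β : Fin N) (i j : ℕ),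
      quadMat η (commSer r r') (β.castSucc, j) (Fin.last N, i) =
        quadMat η (commSer r r') (Fin.last N, i) (β.castSucc, j) := fun β i j => by
    simp only [quadMat, rUp_castSucc_last, rUp_castSucc, ← mul_assoc, ← pow_add, add_comm j i]
    congr 1
    exact neg_one_pow_eq_of_even_add ⟨i + j + 1, by ring⟩
  have hcomm : ∀ a b : Fin (N + 1) × ℕ, quadAct η r r' a b - quadAct η r' r a b =
      quadAct η r r' b a - quadAct η r' r b a := fun a b => by
    rw [quadAct_comm hsym hinv hr', quadAct_comm hsym hinv hr]
  induction β using Fin.lastCases with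
  | last =>
    induction α using Fin.lastCases with
    | last =>
      rw [quadAct_sub_last hsym hr hr']
      simp [quadMat]
    | cast α =>
      rw [hcomm, quadAct_sub_castSucc hsym hinv hr hr', hlast,
        if_neg fun h => (Fin.castSucc_lt_last α).ne h.1]
      ring
  | cast β =>
    have hβ : β.castSucc ≠ Fin.last N := (Fin.castSucc_lt_last β).ne
    rw [if_neg fun h => hβ h.2, add_zero]
    induction α using Fin.lastCases with
    | last =>
      rw [quadAct_sub_castSucc hsym hinv hr hr', hlast]
      ring
    | cast α =>
      rw [← quadAct_sub_castSucc hsym hinv hr hr', ← quadAct_sub_castSucc hsym hinv hr hr',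
        hcomm (β.castSucc, j)]
      ring

end IndexRaising

section TruncatedSums

variable {M : Type*} [AddCommMonoid M]

theorem finsum_eq_sum_range {f : ℕ → M} {n : ℕ} (h : ∀ i, n ≤ i → f i = 0) :
    ∑ᶠ i, f i = ∑ i ∈ Finset.range n, f i := by
  refine finsum_eq_sum_of_support_subset _ fun i hi => ?_
  rw [Finset.coe_range, Set.mem_Iio]
  by_contra hn
  exact hi (h i (not_lt.1 hn))

theorem finsum_finsum_eq_sum_range {f : ℕ → ℕ → M} {n : ℕ}
    (h : ∀ i j, n ≤ i ∨ n ≤ j → f i j = 0) :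
    ∑ᶠ i, ∑ᶠ j, f i j = ∑ i ∈ Finset.range n, ∑ j ∈ Finset.range n, f i j := by
  have hj : ∀ i, ∑ᶠ j, f i j = ∑ j ∈ Finset.range n, f i j := fun i =>
    finsum_eq_sum_range fun j hj => h i j (Or.inr hj)
  simp only [hj]
  exact finsum_eq_sum_range fun i hi => Finset.sum_eq_zero fun j _ => h i j (Or.inl hi)

theorem sum_range_extend {f : ℕ → M} {n m : ℕ} (hnm : n ≤ m) (h : ∀ i, n ≤ i → f i = 0) :
    ∑ i ∈ Finset.range n, f i = ∑ i ∈ Finset.range m, f i := by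
  refine Finset.sum_subset (Finset.range_subset_range.2 hnm) fun i _ hi => h i ?_
  simpa using hi

theorem finsum_finsum_succ_eq {g : ℕ → ℕ → M} {n : ℕ} (h0 : ∀ j, g 0 j = 0)
    (h : ∀ i j, n ≤ i + j → g i j = 0) :
    ∑ᶠ i, ∑ᶠ j, g (i + 1) j =
      ∑ k ∈ Finset.range n, ∑ j ∈ Finset.range (k + 1), g (k - j) j := by
  rw [finsum_finsum_eq_sum_range (f := fun i j => g (i + 1) j) (n := n)
    (fun i j hij => h _ _ (by omega)), Finset.sum_range_diag_flip n fun j i => g i j,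
    Finset.sum_comm]
  refine Finset.sum_congr rfl fun j _ => ?_
  rw [sum_range_extend (m := n + 1) (by omega) fun i hi => h i j (by omega),
    Finset.sum_range_succ', h0, add_zero]

theorem sum_range_antidiagonal_eq {h : ℕ → ℕ → M} {n m : ℕ} (hnm : 2 * n ≤ m)
    (hh : ∀ i j, n ≤ i ∨ n ≤ j → h i j = 0) :
    ∑ q ∈ Finset.range (m + 1), ∑ i ∈ Finset.range q, h i (q - 1 - i) =
      ∑ i ∈ Finset.range n, ∑ j ∈ Finset.range n, h i j := by
  rw [Finset.sum_range_succ', Finset.range_zero, Finset.sum_empty, add_zero]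
  simp only [Nat.add_sub_cancel]
  rw [Finset.sum_range_diag_flip m h, ← sum_range_extend (n := n) (by omega) fun i hi =>
    Finset.sum_eq_zero fun j _ => hh i j (Or.inl hi)]
  refine Finset.sum_congr rfl fun i hi => ?_
  have := Finset.mem_range.1 hi
  exact (sum_range_extend (by omega) fun j hj => hh i j (Or.inr hj)).symm

end TruncatedSums

section HatOperators

variable {N : ℕ}

/-- The variables `q^α_a` with `a < n`. -/
def varsBelow (N n : ℕ) : Finset (Fin (N + 1) × ℕ) :=
  Finset.univ ×ˢ Finset.range n

theorem sum_varsBelow {M : Type*} [AddCommMonoid M] (n : ℕ) (f : Fin (N + 1) × ℕ → M) :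
    ∑ a ∈ varsBelow N n, f a = ∑ k ∈ Finset.range n, ∑ α, f (α, k) := by
  rw [varsBelow, Finset.sum_product_right]

theorem exists_vars_subset_varsBelow (P : Vp N) : ∃ n, P.vars ⊆ varsBelow N n := by
  refine ⟨P.vars.sup Prod.snd + 1, fun a ha => ?_⟩
  have := Finset.le_sup (f := Prod.snd) ha
  simp only [varsBelow, Finset.mem_product, Finset.mem_univ, Finset.mem_range, true_and]
  omega

theorem pderiv_eq_zero_of_le {P : Vp N} {n : ℕ} (hP : P.vars ⊆ varsBelow N n)
    (α : Fin (N + 1)) {k : ℕ} (hk : n ≤ k) : MvPolynomial.pderiv (α, k) P = 0 := by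
  refine MvPolynomial.pderiv_eq_zero_of_notMem_vars fun h => ?_
  have := hP h
  simp only [varsBelow, Finset.mem_product, Finset.mem_univ, Finset.mem_range, true_and] at this
  omega

theorem pderiv_pderiv_comm (a b : Fin (N + 1) × ℕ) (P : Vp N) :
    MvPolynomial.pderiv a (MvPolynomial.pderiv b P) =
      MvPolynomial.pderiv b (MvPolynomial.pderiv a P) := by
  classical
  rw [pderiv_eq_constDer b, pderiv_constDer]

theorem pderiv_pderiv_eq_zero_of_le {P : Vp N} {n : ℕ} (hP : P.vars ⊆ varsBelow N n)
    (α β : Fin (N + 1)) {i j : ℕ} (h : n ≤ i ∨ n ≤ j) :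
    MvPolynomial.pderiv (α, i) (MvPolynomial.pderiv (β, j) P) = 0 := by
  rcases h with h | h
  · rw [pderiv_pderiv_comm, pderiv_eq_zero_of_le hP α h, map_zero]
  · rw [pderiv_eq_zero_of_le hP β h, map_zero]

theorem smul_eq_CC_mul (c : ℂ) (P : Vp N) : c • P = MvPolynomial.C (Polynomial.C c) * P := by
  rw [← MvPolynomial.smul_eq_C_mul, ← Polynomial.algebraMap_eq, algebraMap_smul]

variable (η : Matrix (Fin N) (Fin N) ℂ) (r r' : ℕ → Matrix (Fin (N + 1)) (Fin (N + 1)) ℂ)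

/-- The coefficients of the constant coefficient derivation in `hatRo`. -/
def shiftCoef (a : Fin (N + 1) × ℕ) : Polynomial ℂ :=
  Polynomial.X * Polynomial.C ((-1) ^ a.2 * rUp N η r a.2 (Fin.last N) a.1)

/-- The first order part of `hatRo`. -/
def linDer : Derivation (Polynomial ℂ) (Vp N) (Vp N) :=
  MvPolynomial.mkDerivation _ fun a =>
    ∑ c ∈ varsBelow N (a.2 + 1),
      MvPolynomial.C (Polynomial.C (-r (a.2 - c.2) a.1 c.1)) * MvPolynomial.X c +
    MvPolynomial.C (shiftCoef η r a)

/-- The coefficients of the second order part of `hatRo`. -/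
def quadCoef (a b : Fin (N + 1) × ℕ) : Polynomial ℂ :=
  Polynomial.X ^ 2 * Polynomial.C (1 / 2 * quadMat η r a b)

variable {r} in
theorem hatRo_eq (h0 : r 0 = 0) (P : Vp N) :
    hatRo N η r P = linDer η r P + secondOrder (quadCoef η r) P := by
  obtain ⟨n, hP⟩ := exists_vars_subset_varsBelow P
  have h₁ : (∑ᶠ i : ℕ, ∑ᶠ j : ℕ, ∑ μ : Fin (N + 1), ∑ ν : Fin (N + 1),
      r (i + 1) μ ν • (MvPolynomial.X (ν, j) * MvPolynomial.pderiv (μ, i + 1 + j) P)) =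
      ∑ k ∈ Finset.range n, ∑ j ∈ Finset.range (k + 1), ∑ μ, ∑ ν,
        r (k - j) μ ν • (MvPolynomial.X (ν, j) * MvPolynomial.pderiv (μ, k - j + j) P) :=
    finsum_finsum_succ_eq (g := fun i j => ∑ μ : Fin (N + 1), ∑ ν : Fin (N + 1),
      r i μ ν • (MvPolynomial.X (ν, j) * MvPolynomial.pderiv (μ, i + j) P))
      (fun j => by simp [h0])
      fun i j hij => by simp [pderiv_eq_zero_of_le hP _ hij]
  have h₂ : (∑ᶠ i : ℕ, ∑ ν : Fin N, ((-1 : ℂ) ^ (i + 1) * rTop N η r (i + 1) ν) •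
      MvPolynomial.pderiv (ν.castSucc, i + 1) P) =
      ∑ k ∈ Finset.range n, ∑ α, ((-1 : ℂ) ^ k * rUp N η r k (Fin.last N) α) •
        MvPolynomial.pderiv (α, k) P := by
    set g : ℕ → Vp N := fun k => ∑ ν : Fin N, ((-1 : ℂ) ^ k * rTop N η r k ν) •
      MvPolynomial.pderiv (ν.castSucc, k) P with hg
    have hgn : ∀ k, n ≤ k → g k = 0 := fun k hk => by simp [hg, pderiv_eq_zero_of_le hP _ hk]
    have hg0 : g 0 = 0 := by simp [hg, rTop, h0]
    refine (finsum_eq_sum_range (f := fun i => g (i + 1)) (n := n)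
      fun i hi => hgn _ (by omega)).trans ?_
    rw [← add_zero (∑ i ∈ Finset.range n, g (i + 1)), ← hg0, ← Finset.sum_range_succ' g,
      ← sum_range_extend n.le_succ hgn]
    simp [hg, Fin.sum_univ_castSucc, rTop_eq_raiseIdx]
  have h₃ : (∑ᶠ i : ℕ, ∑ᶠ j : ℕ, ∑ α : Fin (N + 1), ∑ β : Fin (N + 1),
        ((-1 : ℂ) ^ j * rUp N η r (i + j + 1) α β) •
          MvPolynomial.pderiv (α, i) (MvPolynomial.pderiv (β, j) P)) =
      ∑ i ∈ Finset.range n, ∑ j ∈ Finset.range n, ∑ α, ∑ β,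
        ((-1 : ℂ) ^ j * rUp N η r (i + j + 1) α β) •
          MvPolynomial.pderiv (α, i) (MvPolynomial.pderiv (β, j) P) :=
    finsum_finsum_eq_sum_range fun i j hij => by simp [pderiv_pderiv_eq_zero_of_le hP _ _ hij]
  rw [hatRo, h₁, h₂, h₃, derivation_eq_sum_pderiv _ hP, secondOrder_eq_sum _ hP]
  simp only [sum_varsBelow, linDer, MvPolynomial.mkDerivation_X, add_mul, Finset.sum_add_distrib]
  congr 1
  · congr 1
    · rw [← Finset.sum_neg_distrib]
      refine Finset.sum_congr rfl fun k _ => ?_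
      rw [Finset.sum_comm, ← Finset.sum_neg_distrib]
      refine Finset.sum_congr rfl fun μ _ => ?_
      rw [Finset.sum_mul, ← Finset.sum_neg_distrib]
      refine Finset.sum_congr rfl fun j hj => ?_
      have := Finset.mem_range.1 hj
      rw [Finset.sum_mul, ← Finset.sum_neg_distrib, show k - j + j = k by omega]
      refine Finset.sum_congr rfl fun ν _ => ?_
      rw [smul_eq_CC_mul, map_neg, map_neg]
      ring
    · rw [Finset.mul_sum]
      refine Finset.sum_congr rfl fun k _ => ?_
      rw [Finset.mul_sum]
      refine Finset.sum_congr rfl fun α _ => ?_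
      rw [smul_eq_CC_mul, shiftCoef, map_mul MvPolynomial.C]
      ring
  · rw [smul_eq_CC_mul, Finset.mul_sum, Finset.mul_sum]
    refine Finset.sum_congr rfl fun i _ => ?_
    simp only [Finset.mul_sum]
    rw [Finset.sum_comm]
    refine Finset.sum_congr rfl fun α _ => ?_
    refine Finset.sum_congr rfl fun j _ => ?_
    refine Finset.sum_congr rfl fun β _ => ?_
    simp only [smul_eq_CC_mul, quadCoef, quadMat, map_mul MvPolynomial.C, map_mul Polynomial.C]
    ring

/-- The coefficients of the first order part of the correction term. -/
def corrShift (a : Fin (N + 1) × ℕ) : Polynomial ℂ :=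
  if a.1 = Fin.last N then Polynomial.X * Polynomial.C (Gcoef N η r r' a.2) else 0

/-- The coefficients of the second order part of the correction term. -/
def corrQuad (a b : Fin (N + 1) × ℕ) : Polynomial ℂ :=
  if a.1 = Fin.last N ∧ b.1 = Fin.last N then
    Polynomial.X ^ 2 * Polynomial.C (1 / 2 * Gcoef N η r r' (a.2 + b.2 + 1) * (-1) ^ (a.2 + 1))
  else 0

theorem correction_eq (P : Vp N) :
    ∑ᶠ p : ℕ, Gcoef N η r r' (p + 3) •
      (MvPolynomial.C Polynomial.X * MvPolynomial.pderiv (Fin.last N, p + 3) P +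
       (1 / 2 : ℂ) • (MvPolynomial.C (Polynomial.X ^ 2) *
         ∑ i ∈ Finset.range (p + 3), ((-1 : ℂ) ^ (i + 1)) •
           MvPolynomial.pderiv ((Fin.last N : Fin (N + 1)), i)
             (MvPolynomial.pderiv (Fin.last N, p + 2 - i) P))) =
    constDer (corrShift η r r') P + secondOrder (corrQuad η r r') P := by
  obtain ⟨n, hP⟩ := exists_vars_subset_varsBelow P
  set t : ℕ → Vp N := fun q => Gcoef N η r r' q •
      (MvPolynomial.C Polynomial.X * MvPolynomial.pderiv (Fin.last N, q) P +
       (1 / 2 : ℂ) • (MvPolynomial.C (Polynomial.X ^ 2) *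
         ∑ i ∈ Finset.range q, ((-1 : ℂ) ^ (i + 1)) •
           MvPolynomial.pderiv ((Fin.last N : Fin (N + 1)), i)
             (MvPolynomial.pderiv (Fin.last N, q - 1 - i) P))) with ht
  have h₁ : (∑ᶠ p : ℕ, t (p + 3)) = ∑ q ∈ Finset.range (2 * n + 2 + 1), t q := by
    rw [finsum_eq_sum_range (n := 2 * n) fun p hp => ?_, Finset.sum_range_succ' t,
      Finset.sum_range_succ', Finset.sum_range_succ']
    · simp [ht, Gcoef_eq_zero_of_lt_three]
    · simp only [ht]
      rw [pderiv_eq_zero_of_le hP _ (by omega), Finset.sum_eq_zero fun i hi => by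
        rw [pderiv_pderiv_eq_zero_of_le hP _ _ (by omega), smul_zero]]
      simp
  have h₂ : ∀ q, t q = MvPolynomial.C (Polynomial.X * Polynomial.C (Gcoef N η r r' q)) *
        MvPolynomial.pderiv (Fin.last N, q) P +
      ∑ i ∈ Finset.range q,
        MvPolynomial.C (corrQuad η r r' (Fin.last N, i) (Fin.last N, q - 1 - i)) *
          MvPolynomial.pderiv (Fin.last N, i)
            (MvPolynomial.pderiv (Fin.last N, q - 1 - i) P) := fun q => by
    simp only [ht, smul_eq_CC_mul, mul_add, Finset.mul_sum]
    refine congrArg₂ (· + ·) ?_ ?_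
    · rw [map_mul MvPolynomial.C]
      ring
    · refine Finset.sum_congr rfl fun i hi => ?_
      have := Finset.mem_range.1 hi
      simp only [corrQuad, and_self, if_true, show i + (q - 1 - i) + 1 = q by omega,
        map_mul MvPolynomial.C, map_mul Polynomial.C]
      ring
  refine h₁.trans ?_
  simp only [h₂, Finset.sum_add_distrib]
  rw [sum_range_antidiagonal_eq (n := n) (m := 2 * n + 2)
      (h := fun i j => MvPolynomial.C (corrQuad η r r' (Fin.last N, i) (Fin.last N, j)) *
        MvPolynomial.pderiv (Fin.last N, i) (MvPolynomial.pderiv (Fin.last N, j) P))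
      (by omega) fun i j hij => by rw [pderiv_pderiv_eq_zero_of_le hP _ _ hij, mul_zero],
    ← sum_range_extend (n := n) (by omega) fun i hi => by
      rw [pderiv_eq_zero_of_le hP _ hi, mul_zero],
    constDer_eq_sum _ hP, secondOrder_eq_sum _ hP]
  have hne : ∀ α : Fin N, α.castSucc ≠ Fin.last N := fun α => (Fin.castSucc_lt_last α).ne
  simp [sum_varsBelow, Fin.sum_univ_castSucc, corrShift, corrQuad, hne]

theorem linDer_X (a : Fin (N + 1) × ℕ) :
    linDer η r (MvPolynomial.X a) = ∑ c ∈ varsBelow N (a.2 + 1),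
      MvPolynomial.C (Polynomial.C (-r (a.2 - c.2) a.1 c.1)) * MvPolynomial.X c +
    MvPolynomial.C (shiftCoef η r a) :=
  MvPolynomial.mkDerivation_X _ _ _

theorem linDer_linDer_X (α : Fin (N + 1)) (k : ℕ) :
    linDer η r (linDer η r' (MvPolynomial.X (α, k))) =
      ∑ m ∈ Finset.range (k + 1), ∑ ε,
        MvPolynomial.C (Polynomial.C (convSer r' r (k - m) α ε)) * MvPolynomial.X (ε, m) -
      MvPolynomial.C (Polynomial.X * Polynomial.C (∑ l ∈ Finset.range (k + 1),
        ∑ γ, r' (k - l) α γ * ((-1) ^ l * rUp N η r l (Fin.last N) γ))) := by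
  rw [linDer_X η r', map_add, MvPolynomial.derivation_C, add_zero, map_sum]
  simp only [Derivation.leibniz, MvPolynomial.derivation_C, smul_eq_mul, mul_zero, add_zero,
    linDer_X, mul_add, Finset.sum_add_distrib]
  rw [sub_eq_add_neg]
  refine congrArg₂ (· + ·) ?_ ?_
  · simp only [sum_varsBelow, Finset.mul_sum]
    have h₁ : ∀ l ∈ Finset.range (k + 1), ∑ γ : Fin (N + 1), ∑ m ∈ Finset.range (l + 1),
        ∑ ε : Fin (N + 1), MvPolynomial.C (Polynomial.C (-r' (k - l) α γ)) *
          (MvPolynomial.C (Polynomial.C (-r (l - m) γ ε)) * MvPolynomial.X (ε, m)) =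
        ∑ m ∈ Finset.range (l + 1), ∑ ε : Fin (N + 1),
          (MvPolynomial.C (Polynomial.C ((r' (k - m - (l - m)) * r (l - m)) α ε)) *
            MvPolynomial.X (ε, m) : Vp N) := fun l hl => by
      rw [Finset.sum_comm]
      refine Finset.sum_congr rfl fun m hm => ?_
      have := Finset.mem_range.1 hl
      have := Finset.mem_range.1 hm
      rw [Finset.sum_comm, show k - m - (l - m) = k - l by omega]
      refine Finset.sum_congr rfl fun ε _ => ?_
      rw [Matrix.mul_apply, map_sum, map_sum, Finset.sum_mul]
      refine Finset.sum_congr rfl fun γ _ => ?_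
      simp only [map_mul, map_neg]
      ring
    rw [Finset.sum_congr rfl h₁, Finset.sum_range_diag_flip (k + 1) fun m j =>
      ∑ ε : Fin (N + 1), (MvPolynomial.C (Polynomial.C ((r' (k - m - j) * r j) α ε)) *
            MvPolynomial.X (ε, m) : Vp N)]
    refine Finset.sum_congr rfl fun m hm => ?_
    have := Finset.mem_range.1 hm
    rw [Finset.sum_comm, show k + 1 - m = k - m + 1 by omega]
    refine Finset.sum_congr rfl fun ε _ => ?_
    rw [← Finset.sum_mul, ← map_sum, ← map_sum, ← Matrix.sum_apply, convSer_flip]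
  · simp only [sum_varsBelow, shiftCoef, map_sum, Finset.mul_sum, ← Finset.sum_neg_distrib]
    refine Finset.sum_congr rfl fun l _ => Finset.sum_congr rfl fun γ _ => ?_
    simp only [map_mul, map_neg]
    ring

variable {η r r'}

theorem lie_linDer (hsym : η.IsSymm) (hinv : IsUnit η.det) (hr : memGoPlus N η r)
    (hr' : memGoPlus N η r') :
    ⁅linDer η r, linDer η r'⁆ = linDer η (commSer r r') + constDer (corrShift η r r') := by
  refine MvPolynomial.derivation_ext fun a => ?_
  obtain ⟨α, k⟩ := a
  have hcorr : corrShift η r r' (α, k) = Polynomial.X * Polynomial.C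
      (if α = Fin.last N then Gcoef N η r r' k else 0) := by
    by_cases h : α = Fin.last N <;> simp [corrShift, h]
  have hshift := shift_commutator hsym hinv hr hr' α k
  rw [Derivation.commutator_apply, linDer_linDer_X, linDer_linDer_X, sub_sub_sub_comm,
    Derivation.add_apply, linDer_X, constDer_X, hcorr, add_assoc, ← map_add, shiftCoef, ← mul_add,
    ← map_add, ← hshift, ← Finset.sum_sub_distrib, sub_eq_add_neg]
  congr 1
  · rw [sum_varsBelow]
    refine Finset.sum_congr rfl fun m _ => ?_
    rw [← Finset.sum_sub_distrib]
    refine Finset.sum_congr rfl fun ε _ => ?_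
    rw [← sub_mul, ← map_sub, ← map_sub, commSer_eq, Matrix.sub_apply, neg_sub]
  · simp only [map_sub, mul_sub]
    ring

theorem isSecondOrder_quadCoef (hsym : η.IsSymm) (hinv : IsUnit η.det) (hr : memGoPlus N η r) :
    IsSecondOrder (secondOrder (quadCoef η r))
      fun a b => Polynomial.X ^ 2 * Polynomial.C (quadMat η r a b) := by
  convert isSecondOrder_secondOrder (quadCoef η r) using 3 with a b
  rw [quadCoef, quadCoef, quadMat_comm hsym hinv hr a b, ← mul_add, ← map_add]
  congr 2
  ring

theorem isSecondOrder_lie_linDer (hsym : η.IsSymm) (hinv : IsUnit η.det)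
    (hr' : memGoPlus N η r') :
    IsSecondOrder ((linDer η r : Vp N →ₗ[Polynomial ℂ] Vp N) ∘ₗ secondOrder (quadCoef η r') -
        secondOrder (quadCoef η r') ∘ₗ linDer η r)
      fun a b => Polynomial.X ^ 2 * Polynomial.C (quadAct η r r' a b) := by
  have h := (isSecondOrder_quadCoef hsym hinv hr').lie (linDer η r)
    (fun a => varsBelow N (a.2 + 1)) (fun a c => Polynomial.C (-r (a.2 - c.2) a.1 c.1))
    (shiftCoef η r) (linDer_X η r)
  have hsum : ∀ (a : Fin (N + 1) × ℕ) (f : Fin (N + 1) × ℕ → ℂ),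
      -∑ c ∈ varsBelow N (a.2 + 1), Polynomial.C (-r (a.2 - c.2) a.1 c.1) *
        (Polynomial.X ^ 2 * Polynomial.C (f c)) =
      Polynomial.X ^ 2 * Polynomial.C (∑ l ∈ Finset.range (a.2 + 1), ∑ γ,
        r (a.2 - l) a.1 γ * f (γ, l)) := fun a f => by
    rw [sum_varsBelow, map_sum, Finset.mul_sum, ← Finset.sum_neg_distrib]
    refine Finset.sum_congr rfl fun l _ => ?_
    rw [map_sum, Finset.mul_sum, ← Finset.sum_neg_distrib]
    refine Finset.sum_congr rfl fun γ _ => ?_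
    rw [Polynomial.C_mul, Polynomial.C_neg]
    ring
  simp only [sub_eq_add_neg, hsum] at h
  simpa only [quadAct, Polynomial.C_add, mul_add, sub_eq_add_neg] using h

theorem lie_secondOrder (hsym : η.IsSymm) (hinv : IsUnit η.det) (hr : memGoPlus N η r)
    (hr' : memGoPlus N η r') :
    ((linDer η r : Vp N →ₗ[Polynomial ℂ] Vp N) ∘ₗ secondOrder (quadCoef η r') -
        secondOrder (quadCoef η r') ∘ₗ linDer η r) -
      ((linDer η r' : Vp N →ₗ[Polynomial ℂ] Vp N) ∘ₗ secondOrder (quadCoef η r) -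
        secondOrder (quadCoef η r) ∘ₗ linDer η r') =
    secondOrder (quadCoef η (commSer r r')) + secondOrder (corrQuad η r r') := by
  refine ((isSecondOrder_lie_linDer hsym hinv hr').sub
    (isSecondOrder_lie_linDer hsym hinv hr)).eq ?_
  convert (isSecondOrder_secondOrder (quadCoef η (commSer r r'))).add
    (isSecondOrder_secondOrder (corrQuad η r r')) using 1
  funext a b
  simp only [Pi.sub_apply, Pi.add_apply]
  rw [← mul_sub, ← map_sub, quadAct_sub hsym hinv hr hr']
  by_cases h : a.1 = Fin.last N ∧ b.1 = Fin.last N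
  · rw [corrQuad, corrQuad, if_pos h, if_pos h, if_pos h.symm, add_comm b.2 a.2]
    simp only [quadCoef, map_add, map_mul]
    ring
  · rw [corrQuad, corrQuad, if_neg h, if_neg h, if_neg fun h' => h h'.symm]
    simp only [quadCoef, map_add, map_mul, map_zero]
    ring

end HatOperators

/-- the commutation relation for the operators `r̂^o`, and the vanishing of `G_p`
for even `p`. -/
theorem commutator_hatRo (N : ℕ) (hN : 1 ≤ N)
    (η : Matrix (Fin N) (Fin N) ℂ) (hsym : η.IsSymm) (hinv : IsUnit η.det)
    (r r' : ℕ → Matrix (Fin (N + 1)) (Fin (N + 1)) ℂ)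
    (hr : memGoPlus N η r) (hr' : memGoPlus N η r') :
    (∀ P : Vp N,
      hatRo N η r (hatRo N η r' P) - hatRo N η r' (hatRo N η r P) =
        hatRo N η (commSer r r') P +
        ∑ᶠ p : ℕ, Gcoef N η r r' (p + 3) •
          (MvPolynomial.C Polynomial.X * MvPolynomial.pderiv (Fin.last N, p + 3) P +
           (1 / 2 : ℂ) • (MvPolynomial.C (Polynomial.X ^ 2) *
             ∑ i ∈ Finset.range (p + 3), ((-1 : ℂ) ^ (i + 1)) •
               MvPolynomial.pderiv ((Fin.last N : Fin (N + 1)), i)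
                 (MvPolynomial.pderiv (Fin.last N, p + 2 - i) P)))) ∧
    (∀ p : ℕ, 2 ≤ p → Even p → Gcoef N η r r' p = 0) := by
  refine ⟨fun P => ?_, fun p _ hp => Gcoef_eq_zero_of_even hp⟩
  have h₁ := DFunLike.congr_fun (lie_linDer hsym hinv hr hr') P
  have h₂ := LinearMap.congr_fun (lie_secondOrder hsym hinv hr hr') P
  have h₃ := (isSecondOrder_secondOrder (quadCoef η r)).comm
    (isSecondOrder_secondOrder (quadCoef η r')) P
  simp only [Derivation.commutator_apply, Derivation.add_apply, LinearMap.sub_apply,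
    LinearMap.add_apply, LinearMap.comp_apply, Derivation.coeFn_coe] at h₁ h₂
  rw [correction_eq, hatRo_eq η hr.1, hatRo_eq η hr'.1, hatRo_eq η hr'.1, hatRo_eq η hr.1,
    hatRo_eq η (commSer_zero hr.1)]
  simp only [map_add]
  linear_combination h₁ + h₂ + h₃
end
end

section
/- For every b = (b_1,…,b_N) ∈ ℂ^N, one has [b̂, L^{η,A}_{−1}] = b_α A^α ∂/∂t^{N+1}_0 as linear operators on ℂ[ε, ε^{−1}][t^α_a : 1 ≤ α ≤ N+1, a ≥ 0] (here b_α A^α = Σ_{α=1}^N b_α A^α). -/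
noncomputable section

/-- The coefficient ring `ℂ[ε, ε^{−1}]` of Laurent polynomials; `ε = T 1`. -/
abbrev Kε := LaurentPolynomial ℂ

/-- The polynomial algebra `ℂ[ε, ε^{−1}][t^α_a : 1 ≤ α ≤ N+1, a ≥ 0]`. -/
abbrev Wt (N : ℕ) := MvPolynomial (Fin (N + 1) × ℕ) Kε

/-- The shifted variable `q^α_a := t^α_a − A^α δ_{a,1}`. -/
def qv (N : ℕ) (A : Fin (N + 1) → ℂ) (v : Fin (N + 1) × ℕ) : Wt N :=
  MvPolynomial.X v - MvPolynomial.C (LaurentPolynomial.C (if v.2 = 1 then A v.1 else 0))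

/-- The operator `L^{η,A}_{−1} = (ε^{−2}/2) η_{αβ} q^α_0 q^β_0 + ε^{−1} q^{N+1}_0
+ Σ_{d≥1} q^α_d ∂/∂q^α_{d−1}`. -/
def Lm1 (N : ℕ) (η : Matrix (Fin N) (Fin N) ℂ) (A : Fin (N + 1) → ℂ) (P : Wt N) : Wt N :=
  ((LaurentPolynomial.T (-2) : Kε) • ((1 / 2 : ℂ) •
      (∑ α : Fin N, ∑ β : Fin N,
        η α β • (qv N A (α.castSucc, 0) * qv N A (β.castSucc, 0))))) * P +
  ((LaurentPolynomial.T (-1) : Kε) • qv N A (Fin.last N, 0)) * P +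
  ∑ᶠ d : ℕ, ∑ α : Fin (N + 1), qv N A (α, d + 1) * MvPolynomial.pderiv (α, d) P

/-- The operator `b̂ := Σ_{d≥0} b_α t^α_d ∂/∂t^{N+1}_d − ε b^α ∂/∂t^α_0`, where
`b^α := η^{αβ} b_β`. -/
def bHat (N : ℕ) (η : Matrix (Fin N) (Fin N) ℂ) (b : Fin N → ℂ) (P : Wt N) : Wt N :=
  (∑ᶠ d : ℕ, ∑ α : Fin N,
    b α • (MvPolynomial.X (α.castSucc, d) * MvPolynomial.pderiv (Fin.last N, d) P)) -
  (LaurentPolynomial.T 1 : Kε) •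
    (∑ α : Fin N, (∑ β : Fin N, η⁻¹ α β * b β) • MvPolynomial.pderiv (α.castSucc, 0) P)

theorem Derivation.finset_sum_apply {R A M ι : Type*} [CommSemiring R] [CommSemiring A]
    [AddCommMonoid M] [Algebra R A] [Module A M] [Module R M] (s : Finset ι)
    (D : ι → Derivation R A M) (a : A) : (∑ i ∈ s, D i) a = ∑ i ∈ s, D i a := by
  rw [← Derivation.coeFnAddMonoidHom_apply, map_sum, Finset.sum_apply]
  rfl

open MvPolynomial in
theorem finsum_sum_mul_pderiv_eq_mkDerivation {R ι : Type*} [CommRing R] [Fintype ι]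
    (f : ι × ℕ → MvPolynomial (ι × ℕ) R) (P : MvPolynomial (ι × ℕ) R) :
    ∑ᶠ d : ℕ, ∑ i : ι, f (i, d) * pderiv (i, d) P = mkDerivation R f P := by
  classical
  set s : Finset ℕ := P.vars.image Prod.snd
  have hmem : ∀ v ∈ P.vars, v.2 ∈ s := fun v hv => Finset.mem_image_of_mem _ hv
  rw [finsum_eq_sum_of_support_subset (s := s)]
  · have key : (∑ d ∈ s, ∑ i : ι, f (i, d) • pderiv (R := R) (i, d)) P = mkDerivation R f P := by
      refine derivation_eq_of_forall_mem_vars fun v hv => ?_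
      obtain ⟨j, e⟩ := v
      have he : e ∈ s := hmem _ hv
      simp only [Derivation.finset_sum_apply, Derivation.smul_apply, smul_eq_mul,
        mkDerivation_X, pderiv_X]
      rw [Finset.sum_eq_single_of_mem e he, Finset.sum_eq_single_of_mem j (Finset.mem_univ _)]
      · simp
      · intro i _ hi
        simp [hi.symm]
      · intro d _ hd
        simp [hd.symm]
    simpa only [Derivation.finset_sum_apply, Derivation.smul_apply, smul_eq_mul] using key
  · intro d hd
    by_contra hds
    refine hd (Finset.sum_eq_zero fun i _ => ?_)
    rw [pderiv_eq_zero_of_notMem_vars fun hv => hds (hmem _ hv), mul_zero]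

/-- The constant `c ∈ ℂ` as an element of the polynomial algebra. -/
def scalar (N : ℕ) : ℂ →+* Wt N := MvPolynomial.C.comp LaurentPolynomial.C

/-- The Laurent monomial `ε^n` as an element of the polynomial algebra. -/
def epsPow (N : ℕ) (n : ℤ) : Wt N := MvPolynomial.C (LaurentPolynomial.T n)

theorem complex_smul_eq_mul {N : ℕ} (c : ℂ) (P : Wt N) : c • P = scalar N c * P := by
  rw [scalar, RingHom.comp_apply, ← MvPolynomial.smul_eq_C_mul]
  exact (algebraMap_smul Kε c P).symm

theorem T_smul_eq_mul {N : ℕ} (n : ℤ) (P : Wt N) :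
    (LaurentPolynomial.T n : Kε) • P = epsPow N n * P :=
  MvPolynomial.smul_eq_C_mul _ _

theorem epsPow_neg_two_mul (N : ℕ) : epsPow N (-2) * epsPow N 1 = epsPow N (-1) := by
  rw [epsPow, epsPow, ← map_mul, ← LaurentPolynomial.T_add]
  rfl

theorem derivation_scalar {N : ℕ} (D : Derivation Kε (Wt N) (Wt N)) (c : ℂ) :
    D (scalar N c) = 0 :=
  MvPolynomial.derivation_C D _

theorem derivation_epsPow {N : ℕ} (D : Derivation Kε (Wt N) (Wt N)) (n : ℤ) :
    D (epsPow N n) = 0 :=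
  MvPolynomial.derivation_C D _

theorem derivation_scalar_mul {N : ℕ} (D : Derivation Kε (Wt N) (Wt N)) (c : ℂ) (P : Wt N) :
    D (scalar N c * P) = scalar N c * D P := by
  rw [Derivation.leibniz, derivation_scalar, smul_zero, add_zero, smul_eq_mul]

theorem derivation_epsPow_mul {N : ℕ} (D : Derivation Kε (Wt N) (Wt N)) (n : ℤ) (P : Wt N) :
    D (epsPow N n * P) = epsPow N n * D P := by
  rw [Derivation.leibniz, derivation_epsPow, smul_zero, add_zero, smul_eq_mul]

theorem derivation_qv {N : ℕ} (A : Fin (N + 1) → ℂ) (D : Derivation Kε (Wt N) (Wt N))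
    (v : Fin (N + 1) × ℕ) : D (qv N A v) = D (MvPolynomial.X v) := by
  rw [qv, map_sub, MvPolynomial.derivation_C, sub_zero]

theorem qv_zero {N : ℕ} (A : Fin (N + 1) → ℂ) (α : Fin (N + 1)) :
    qv N A (α, 0) = MvPolynomial.X (α, 0) := by
  simp [qv]

/-- The derivation part `Σ_{d≥1} q^α_d ∂/∂q^α_{d−1}` of `L^{η,A}_{−1}`. -/
def Lm1Derivation (N : ℕ) (A : Fin (N + 1) → ℂ) : Derivation Kε (Wt N) (Wt N) :=
  MvPolynomial.mkDerivation Kε fun v => qv N A (v.1, v.2 + 1)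

/-- The multiplication part of `L^{η,A}_{−1}`. -/
def Lm1Potential (N : ℕ) (η : Matrix (Fin N) (Fin N) ℂ) : Wt N :=
  epsPow N (-2) * (scalar N (1 / 2) * ∑ α : Fin N, ∑ β : Fin N, scalar N (η α β) *
    (MvPolynomial.X (α.castSucc, 0) * MvPolynomial.X (β.castSucc, 0))) +
  epsPow N (-1) * MvPolynomial.X (Fin.last N, 0)

/-- The operator `b̂` as a derivation. -/
def bHatDerivation (N : ℕ) (η : Matrix (Fin N) (Fin N) ℂ) (b : Fin N → ℂ) :
    Derivation Kε (Wt N) (Wt N) :=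
  MvPolynomial.mkDerivation Kε (fun v => if v.1 = Fin.last N then
      ∑ α : Fin N, scalar N (b α) * MvPolynomial.X (α.castSucc, v.2) else 0) -
  ∑ α : Fin N, (epsPow N 1 * scalar N (η⁻¹.mulVec b α)) • MvPolynomial.pderiv (α.castSucc, 0)

theorem Lm1_eq (N : ℕ) (η : Matrix (Fin N) (Fin N) ℂ) (A : Fin (N + 1) → ℂ) (P : Wt N) :
    Lm1 N η A P = Lm1Potential N η * P + Lm1Derivation N A P := by
  rw [Lm1, Lm1Potential, Lm1Derivation, ← finsum_sum_mul_pderiv_eq_mkDerivation, add_mul]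
  simp only [complex_smul_eq_mul, T_smul_eq_mul, qv_zero]

theorem bHat_eq (N : ℕ) (η : Matrix (Fin N) (Fin N) ℂ) (b : Fin N → ℂ) (P : Wt N) :
    bHat N η b P = bHatDerivation N η b P := by
  rw [bHat, bHatDerivation, Derivation.sub_apply, ← finsum_sum_mul_pderiv_eq_mkDerivation]
  simp only [complex_smul_eq_mul, T_smul_eq_mul]
  congr 1
  · refine finsum_congr fun d => ?_
    simp [Finset.sum_mul, mul_assoc]
  · simp only [Derivation.finset_sum_apply, Derivation.smul_apply, smul_eq_mul, Finset.mul_sum,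
      mul_assoc]
    rfl

theorem bHatDerivation_X_last (N : ℕ) (η : Matrix (Fin N) (Fin N) ℂ) (b : Fin N → ℂ) (d : ℕ) :
    bHatDerivation N η b (MvPolynomial.X (Fin.last N, d)) =
      ∑ α : Fin N, scalar N (b α) * MvPolynomial.X (α.castSucc, d) := by
  simp [bHatDerivation, Derivation.finset_sum_apply, MvPolynomial.pderiv_X,
    (Fin.castSucc_ne_last _).symm]

theorem bHatDerivation_X_castSucc (N : ℕ) (η : Matrix (Fin N) (Fin N) ℂ) (b : Fin N → ℂ)
    (α : Fin N) (d : ℕ) :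
    bHatDerivation N η b (MvPolynomial.X (α.castSucc, d)) =
      if d = 0 then -(epsPow N 1 * scalar N (η⁻¹.mulVec b α)) else 0 := by
  split_ifs with h <;>
  simp [bHatDerivation, Derivation.finset_sum_apply, MvPolynomial.pderiv_X, Pi.single_apply,
    Fin.castSucc_ne_last, h]

theorem bHatDerivation_Lm1Potential (N : ℕ) (η : Matrix (Fin N) (Fin N) ℂ) (hsym : η.IsSymm)
    (hinv : IsUnit η.det) (b : Fin N → ℂ) :
    bHatDerivation N η b (Lm1Potential N η) = 0 := by
  have hmv : ∀ β : Fin N, ∑ α : Fin N, scalar N (η β α) * scalar N (η⁻¹.mulVec b α) =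
      scalar N (b β) := fun β => by
    have h : η.mulVec (η⁻¹.mulVec b) = b := by
      rw [Matrix.mulVec_mulVec, Matrix.mul_nonsing_inv _ hinv, Matrix.one_mulVec]
    simp only [← map_mul, ← map_sum]
    exact congrArg (scalar N) (congrFun h β)
  have hquad : ∑ α : Fin N, ∑ β : Fin N, scalar N (η α β) *
      bHatDerivation N η b (MvPolynomial.X (α.castSucc, 0) * MvPolynomial.X (β.castSucc, 0)) =
      -(epsPow N 1 * (2 * ∑ α : Fin N, scalar N (b α) * MvPolynomial.X (α.castSucc, 0))) := by
    have h1 : ∀ α β : Fin N, scalar N (η α β) *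
        bHatDerivation N η b (MvPolynomial.X (α.castSucc, 0) * MvPolynomial.X (β.castSucc, 0)) =
        -(epsPow N 1 *
          (scalar N (η α β) * scalar N (η⁻¹.mulVec b β) * MvPolynomial.X (α.castSucc, 0)
          + scalar N (η β α) * scalar N (η⁻¹.mulVec b α) * MvPolynomial.X (β.castSucc, 0))) :=
      fun α β => by
        rw [Derivation.leibniz, bHatDerivation_X_castSucc, bHatDerivation_X_castSucc,
          hsym.apply α β]
        simp only [if_true, smul_eq_mul]
        ring
    simp only [h1, Finset.sum_neg_distrib, ← Finset.mul_sum, Finset.sum_add_distrib]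
    rw [Finset.sum_comm (f := fun α β : Fin N =>
      scalar N (η β α) * scalar N (η⁻¹.mulVec b α) * MvPolynomial.X (β.castSucc, 0))]
    simp only [← Finset.sum_mul, hmv, two_mul]
  have h2 : scalar N (1 / 2) * 2 = 1 := by
    rw [← map_ofNat (scalar N) 2, ← map_mul, ← map_one (scalar N)]
    norm_num
  simp only [Lm1Potential, map_add, map_sum, derivation_scalar_mul, derivation_epsPow_mul, hquad,
    bHatDerivation_X_last]
  rw [← epsPow_neg_two_mul]
  linear_combination (-epsPow N (-2) * epsPow N 1 *
    ∑ α : Fin N, scalar N (b α) * MvPolynomial.X (α.castSucc, 0)) * h2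

theorem commutator_bHatDerivation_Lm1Derivation (N : ℕ) (η : Matrix (Fin N) (Fin N) ℂ)
    (A : Fin (N + 1) → ℂ) (b : Fin N → ℂ) :
    ⁅bHatDerivation N η b, Lm1Derivation N A⁆ =
      scalar N (∑ α : Fin N, b α * A α.castSucc) • MvPolynomial.pderiv (Fin.last N, 0) := by
  refine MvPolynomial.derivation_ext fun v => ?_
  obtain ⟨γ, d⟩ := v
  have hL : ∀ v, Lm1Derivation N A (MvPolynomial.X v) = qv N A (v.1, v.2 + 1) := fun v =>
    MvPolynomial.mkDerivation_X _ _ _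
  rw [Derivation.commutator_apply, hL, derivation_qv, Derivation.smul_apply]
  induction γ using Fin.lastCases with
  | last =>
    simp only [bHatDerivation_X_last, map_sum, derivation_scalar_mul, hL,
      ← Finset.sum_sub_distrib, ← mul_sub, Finset.sum_mul, map_mul, smul_eq_mul, mul_assoc]
    refine Finset.sum_congr rfl fun α _ => ?_
    congr 1
    by_cases h : d = 0 <;> simp [qv, h, scalar, MvPolynomial.pderiv_X]
  | cast γ =>
    rw [bHatDerivation_X_castSucc, bHatDerivation_X_castSucc]
    split_ifs <;>
    simp_all [derivation_epsPow, derivation_scalar, MvPolynomial.pderiv_X, Fin.castSucc_ne_last]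

/-- `[b̂, L^{η,A}_{−1}] = b_α A^α ∂/∂t^{N+1}_0`. -/
theorem commutator_bHat_Lm1 (N : ℕ) (hN : 1 ≤ N)
    (η : Matrix (Fin N) (Fin N) ℂ) (hsym : η.IsSymm) (hinv : IsUnit η.det)
    (A : Fin (N + 1) → ℂ) (b : Fin N → ℂ) :
    ∀ P : Wt N,
      bHat N η b (Lm1 N η A P) - Lm1 N η A (bHat N η b P) =
        (∑ α : Fin N, b α * A α.castSucc) • MvPolynomial.pderiv (Fin.last N, 0) P := by
  intro P
  have h := DFunLike.congr_fun (commutator_bHatDerivation_Lm1Derivation N η A b) P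
  rw [Derivation.commutator_apply, Derivation.smul_apply, smul_eq_mul] at h
  rw [complex_smul_eq_mul, ← h]
  simp only [bHat_eq, Lm1_eq, map_add, Derivation.leibniz,
    bHatDerivation_Lm1Potential N η hsym hinv b, smul_eq_mul]
  ring
end
end
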